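/- arXiv:1803.01563 — 4 statements merged into one kernel-verified Lean document; each statement's English description precedes it below -/
import Mathlib

section
/- Let N ≥ 3 be an integer, let τ > N and let θ satisfy 0 < θ and 2+θ < N. Then there exists c > 0 such that for every x ∈ ℝ^N\{0}: (i) ∫_{ℝ^N} (1+|y|)^{-τ} |x-y|^{2-N} dy ≤ c (1+|x|)^{2-N}; and (ii) ∫_{ℝ^N} |y|^{-θ-2}(1+|y|)^{-τ+θ+2} |x-y|^{2-N} dy ≤ c |x|^{-θ}(1+|x|)^{2-N+θ}. -/
open Real MeasureTheory Filter Metric Set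

noncomputable section

/-- The Euclidean Laplacian, as the sum of second directional derivatives along the
coordinate axes. -/
def lap {N : ℕ} (u : EuclideanSpace ℝ (Fin N) → ℝ) (x : EuclideanSpace ℝ (Fin N)) : ℝ :=
  ∑ i : Fin N,
    fderiv ℝ (fun y => fderiv ℝ u y (EuclideanSpace.single i (1:ℝ))) x
      (EuclideanSpace.single i (1:ℝ))

/-- `f` is locally Hölder continuous on `s`. -/
def LocHolderOn {N : ℕ} (f : EuclideanSpace ℝ (Fin N) → ℝ)
    (s : Set (EuclideanSpace ℝ (Fin N))) : Prop :=
  ∀ x ∈ s, ∃ (C α : NNReal) (r : ℝ), 0 < r ∧ 0 < α ∧ α ≤ 1 ∧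
    HolderOnWith C α f (Metric.ball x r ∩ s)

/-- The constant `c_p = ((2/(p-1))(N-2-2/(p-1)))^{1/(p-1)}`. -/
def cp (N : ℕ) (p : ℝ) : ℝ := (2 / (p - 1) * ((N:ℝ) - 2 - 2 / (p - 1))) ^ (1 / (p - 1))

/-- The Joseph–Lundgren exponent `p_c = 1 + 4/(N-4+2√(N-1))`. -/
def pc (N : ℕ) : ℝ := 1 + 4 / ((N:ℝ) - 4 + 2 * Real.sqrt ((N:ℝ) - 1))

/-- The exponent `τ_p^*`. -/
def tauStar (N : ℕ) (p : ℝ) : ℝ :=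
  (2 / (p - 1) - ((N:ℝ) - 2) / 2) -
    Real.sqrt ((2 / (p - 1) - ((N:ℝ) - 2) / 2) ^ 2 - 2 * ((N:ℝ) - 2 - 2 / (p - 1)))

/-- The surface measure `σ_{N-1}` of the unit sphere in `ℝ^N`,
expressed as `N` times the volume of the unit ball. -/
def sphereArea (N : ℕ) : ℝ :=
  (N : ℝ) * (volume (Metric.ball (0 : EuclideanSpace ℝ (Fin N)) 1)).toReal

/-- The normalizing constant `c_N = 1/((N-2)σ_{N-1})` of the fundamental solution of `-Δ`. -/
def cGreen (N : ℕ) : ℝ := 1 / (((N:ℝ) - 2) * sphereArea N)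

/-- `u` is a `ν`-fast decaying solution of `-Δ u = V u^p` in `ℝ^N \ {0}`. -/
def FastDecaySol (N : ℕ) (p : ℝ) (V u : EuclideanSpace ℝ (Fin N) → ℝ) (ν : ℝ) : Prop :=
  ContDiffOn ℝ 2 u {0}ᶜ ∧ (∀ x : EuclideanSpace ℝ (Fin N), x ≠ 0 → 0 < u x) ∧
  (∀ x : EuclideanSpace ℝ (Fin N), x ≠ 0 → -lap u x = V x * u x ^ p) ∧
  Tendsto (fun x : EuclideanSpace ℝ (Fin N) => u x * ‖x‖ ^ ((N:ℝ) - 2))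
    (Filter.comap (fun x => ‖x‖) Filter.atTop) (nhds ν)

/-- `u(x)|x|^{2/(p-1)} → c_p` as `x → 0`. -/
def SingAtOrigin (N : ℕ) (p : ℝ) (u : EuclideanSpace ℝ (Fin N) → ℝ) : Prop :=
  Tendsto (fun x : EuclideanSpace ℝ (Fin N) => u x * ‖x‖ ^ (2 / (p - 1)))
    (nhdsWithin 0 {0}ᶜ) (nhds (cp N p))

/-- Condition `(V₀)` with parameters `c₀, τ₀, c_∞, β`. -/
def V0cond (N : ℕ) (V : EuclideanSpace ℝ (Fin N) → ℝ) (c₀ τ₀ cinf β : ℝ) : Prop :=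
  LocHolderOn V {0}ᶜ ∧ 0 < c₀ ∧ 0 < τ₀ ∧
  (∀ x : EuclideanSpace ℝ (Fin N), x ≠ 0 → ‖x‖ ≤ 1 → |V x - 1| ≤ c₀ * ‖x‖ ^ τ₀) ∧
  1 ≤ cinf ∧
  ∀ x : EuclideanSpace ℝ (Fin N), x ≠ 0 → 0 ≤ V x ∧ V x ≤ cinf * (1 + ‖x‖) ^ β

/-- The model profile `s^{-a}(1+s)^{a-t}`. -/
def hh (a t s : ℝ) : ℝ := s ^ (-a) * (1 + s) ^ (a - t)

lemma hh_nonneg (a t s : ℝ) (hs : 0 ≤ s) : 0 ≤ hh a t s := by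
  unfold hh; positivity

lemma hh_integrable (N : ℕ) (hN : 3 ≤ N) (a t : ℝ) (ha : a < N) (ht : (N:ℝ) < t) :
    Integrable (fun y : EuclideanSpace ℝ (Fin N) => hh a t ‖y‖) := by
  have : Nonempty (Fin N) := ⟨⟨0, by omega⟩⟩
  rw [integrable_fun_norm_addHaar (μ := (volume : Measure (EuclideanSpace ℝ (Fin N))))
    (f := hh a t)]
  simp only [finrank_euclideanSpace, Fintype.card_fin, smul_eq_mul]
  have hmeas : Measurable (fun y : ℝ => y ^ (N - 1) * hh a t y) := by
    unfold hh; fun_prop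
  rw [← Ioc_union_Ioi_eq_Ioi (zero_le_one (α := ℝ))]
  have key : ∀ y : ℝ, 0 < y → ∀ b : ℝ, y ^ (N - 1) * y ^ (-b) = y ^ ((N:ℝ) - 1 - b) := by
    intro y hy b
    rw [← Real.rpow_natCast, ← Real.rpow_add hy]
    congr 1
    rw [Nat.cast_sub (by omega)]; push_cast; ring
  refine IntegrableOn.union ?_ ?_
  · have h1 : IntegrableOn (fun y : ℝ => y ^ ((N:ℝ) - 1 - a)) (Ioc 0 1) := by
      have := intervalIntegral.intervalIntegrable_rpow' (a := 0) (b := 1)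
        (r := (N:ℝ) - 1 - a) (by linarith)
      rwa [intervalIntegrable_iff_integrableOn_Ioc_of_le zero_le_one] at this
    refine Integrable.mono' h1 hmeas.aestronglyMeasurable ?_
    refine (ae_restrict_iff' measurableSet_Ioc).2 (Eventually.of_forall fun y hy => ?_)
    have hy0 : 0 < y := hy.1
    rw [Real.norm_of_nonneg (mul_nonneg (by positivity) (hh_nonneg _ _ _ hy0.le)), hh, ← mul_assoc,
      key y hy0]
    refine mul_le_of_le_one_right (by positivity) ?_
    exact Real.rpow_le_one_of_one_le_of_nonpos (by linarith) (by linarith)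
  · have h1 : IntegrableOn (fun y : ℝ => y ^ ((N:ℝ) - 1 - t)) (Ioi 1) :=
      integrableOn_Ioi_rpow_of_lt (by linarith) one_pos
    refine Integrable.mono' h1 hmeas.aestronglyMeasurable ?_
    refine (ae_restrict_iff' measurableSet_Ioi).2 (Eventually.of_forall fun y hy => ?_)
    have hy0 : 0 < y := one_pos.trans hy
    rw [Real.norm_of_nonneg (mul_nonneg (by positivity) (hh_nonneg _ _ _ hy0.le)), hh, ← mul_assoc,
      ← key y hy0, mul_assoc]
    refine mul_le_mul_of_nonneg_left ?_ (by positivity)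
    have h2 : y ^ (-t) = y ^ (-a) * y ^ (a - t) := by
      rw [← Real.rpow_add hy0]; congr 1; ring
    rw [h2]
    refine mul_le_mul_of_nonneg_left ?_ (by positivity)
    exact Real.rpow_le_rpow_of_nonpos hy0 (by linarith) (by linarith)

lemma hh_scaled (N : ℕ) (hN : 3 ≤ N) (a t : ℝ) (ha : a < N) (ht : (N:ℝ) < t) (r : ℝ) (hr : 0 < r) :
    Integrable (fun y : EuclideanSpace ℝ (Fin N) => hh a t (‖y‖ / r)) ∧
    ∫ y : EuclideanSpace ℝ (Fin N), hh a t (‖y‖ / r) =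
      r ^ (N:ℝ) * ∫ y : EuclideanSpace ℝ (Fin N), hh a t ‖y‖ := by
  have e : (fun y : EuclideanSpace ℝ (Fin N) => hh a t (‖y‖ / r)) =
      fun y => (fun z : EuclideanSpace ℝ (Fin N) => hh a t ‖z‖) (r⁻¹ • y) := by
    funext y
    simp only [norm_smul, norm_inv, Real.norm_of_nonneg hr.le]
    rw [div_eq_inv_mul]
  constructor
  · rw [e]
    refine (integrable_comp_smul_iff volume
      (fun z : EuclideanSpace ℝ (Fin N) => hh a t ‖z‖) (inv_ne_zero hr.ne')).2 ?_
    exact hh_integrable N hN a t ha ht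
  · rw [e]
    refine (Measure.integral_comp_inv_smul_of_nonneg volume
      (fun z : EuclideanSpace ℝ (Fin N) => hh a t ‖z‖) hr.le).trans ?_
    simp

lemma combine (N : ℕ) (hN : 3 ≤ N) (a t : ℝ) (ha : a < N) (ht : (N:ℝ) < t)
    (ρ r A B : ℝ) (hρ : 0 < ρ) (hr : 0 < r)
    (x : EuclideanSpace ℝ (Fin N)) (F : EuclideanSpace ℝ (Fin N) → ℝ) (hF : ∀ y, 0 ≤ F y)
    (h : ∀ y, F y ≤ A * hh a t (‖y‖ / ρ) + B * hh (N - 2) (N + 1) (‖x - y‖ / r)) :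
    ∫ y, F y ≤ A * (ρ ^ (N:ℝ) * ∫ y : EuclideanSpace ℝ (Fin N), hh a t ‖y‖) +
      B * (r ^ (N:ℝ) * ∫ y : EuclideanSpace ℝ (Fin N), hh (N - 2) (N + 1) ‖y‖) := by
  obtain ⟨i1, e1⟩ := hh_scaled N hN a t ha ht ρ hρ
  obtain ⟨i2, e2⟩ := hh_scaled N hN (N - 2) (N + 1) (by linarith) (by linarith) r hr
  have i2' := i2.comp_sub_left x
  have e2' := integral_sub_left_eq_self
    (fun y : EuclideanSpace ℝ (Fin N) => hh (N - 2) (N + 1) (‖y‖ / r)) volume x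
  rw [← e1, ← e2, ← e2', ← integral_const_mul, ← integral_const_mul,
    ← integral_add (i1.const_mul A) (i2'.const_mul B)]
  exact integral_mono_of_nonneg (Eventually.of_forall hF)
    ((i1.const_mul A).add (i2'.const_mul B)) (Eventually.of_forall h)

lemma near_bound (n s r : ℝ) (hs : 0 ≤ s) (hr : 0 < r) (hsr : s ≤ r) :
    s ^ (2 - n) ≤ 8 * r ^ (2 - n) * hh (n - 2) (n + 1) (s / r) := by
  have h1 : (8:ℝ)⁻¹ ≤ (1 + s / r) ^ ((n - 2) - (n + 1)) := by
    have : (8:ℝ)⁻¹ = (2:ℝ) ^ ((n - 2) - (n + 1)) := by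
      rw [show (n - 2) - (n + 1) = -(3:ℕ) by push_cast; ring, Real.rpow_neg (by norm_num),
        Real.rpow_natCast]; norm_num
    rw [this]
    refine Real.rpow_le_rpow_of_nonpos (by positivity) ?_ (by linarith)
    have : s / r ≤ 1 := (div_le_one hr).2 hsr
    linarith
  have h2 : r ^ (2 - n) * (s / r) ^ (-(n - 2)) = s ^ (2 - n) := by
    rw [show -(n - 2) = 2 - n by ring, Real.div_rpow hs hr.le]
    have : r ^ (2 - n) ≠ 0 := (Real.rpow_pos_of_pos hr _).ne'
    field_simp
  calc s ^ (2 - n) = 8 * s ^ (2 - n) * 8⁻¹ := by ring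
    _ ≤ 8 * s ^ (2 - n) * (1 + s / r) ^ ((n - 2) - (n + 1)) := by gcongr
    _ = _ := by rw [← h2, hh]; ring

set_option maxHeartbeats 1000000 in
/-- The estimate for large `x`. -/
lemma large (N : ℕ) (hN : 3 ≤ N) (a t : ℝ) (ha0 : 0 ≤ a) (ha : a < N) (ht : (N:ℝ) < t) :
    ∃ C : ℝ, 0 < C ∧ ∀ x : EuclideanSpace ℝ (Fin N), 1 ≤ ‖x‖ →
      ∫ y : EuclideanSpace ℝ (Fin N), hh a t ‖y‖ * ‖x - y‖ ^ (2 - (N:ℝ)) ≤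
        C * ‖x‖ ^ (2 - (N:ℝ)) := by
  have hN' : (3:ℝ) ≤ N := by exact_mod_cast hN
  set I1 := ∫ y : EuclideanSpace ℝ (Fin N), hh a t ‖y‖ with hI1
  set I2 := ∫ y : EuclideanSpace ℝ (Fin N), hh (N - 2) (N + 1) ‖y‖ with hI2
  have p1 : 0 ≤ I1 := integral_nonneg fun y => hh_nonneg _ _ _ (norm_nonneg _)
  have p2 : 0 ≤ I2 := integral_nonneg fun y => hh_nonneg _ _ _ (norm_nonneg _)
  refine ⟨(1 / 2) ^ (2 - (N:ℝ)) * I1 + (1 / 2) ^ (-t) * 8 * I2 + 1, by positivity, fun x hx => ?_⟩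
  set r := ‖x‖ with hr
  have r0 : 0 < r := by linarith
  have hb := combine N hN a t ha ht 1 r ((r / 2) ^ (2 - (N:ℝ)))
    ((r / 2) ^ (-t) * (8 * r ^ (2 - (N:ℝ)))) one_pos r0 x
    (fun y => hh a t ‖y‖ * ‖x - y‖ ^ (2 - (N:ℝ)))
    (fun y => mul_nonneg (hh_nonneg _ _ _ (norm_nonneg _)) (by positivity)) (by
      intro y
      have q1 := hh_nonneg a t ‖y‖ (norm_nonneg _)
      have q2 := hh_nonneg (N - 2) (N + 1) (‖x - y‖ / r) (by positivity)
      rw [div_one]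
      rcases le_total (r / 2) ‖x - y‖ with h | h
      · have : ‖x - y‖ ^ (2 - (N:ℝ)) ≤ (r / 2) ^ (2 - (N:ℝ)) :=
          Real.rpow_le_rpow_of_nonpos (by positivity) h (by linarith)
        have := mul_le_mul_of_nonneg_left this q1
        have : 0 ≤ (r / 2) ^ (-t) * (8 * r ^ (2 - (N:ℝ))) * hh (N - 2) (N + 1) (‖x - y‖ / r) := by
          positivity
        linarith
      · have k1 := near_bound N ‖x - y‖ r (norm_nonneg _) r0 (by linarith)
        have hy : r / 2 ≤ ‖y‖ := by
          have := norm_sub_norm_le x y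
          linarith
        have y0 : 0 < ‖y‖ := by linarith
        have k2 : hh a t ‖y‖ ≤ (r / 2) ^ (-t) := by
          have : (r / 2) ^ (-t) = (r / 2) ^ (-a) * (r / 2) ^ (a - t) := by
            rw [← Real.rpow_add (by positivity)]; congr 1; ring
          rw [this, hh]
          gcongr ?_ * ?_
          · exact Real.rpow_le_rpow_of_nonpos (by positivity) hy (by linarith)
          · exact Real.rpow_le_rpow_of_nonpos (by positivity) (by linarith) (by linarith)
        have := mul_le_mul k2 k1 (by positivity) (by positivity)
        have : 0 ≤ (r / 2) ^ (2 - (N:ℝ)) * hh a t ‖y‖ := by positivity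
        linarith)
  refine hb.trans ?_
  rw [← hI1, ← hI2, Real.one_rpow, one_mul]
  clear hb
  clear_value I1 I2 r
  have e1 : (r / 2) ^ (2 - (N:ℝ)) = r ^ (2 - (N:ℝ)) * (1 / 2) ^ (2 - (N:ℝ)) := by
    rw [← Real.mul_rpow (by positivity) (by positivity)]; congr 1; ring
  have e2 : (r / 2) ^ (-t) = r ^ (-t) * (1 / 2) ^ (-t) := by
    rw [← Real.mul_rpow (by positivity) (by positivity)]; congr 1; ring
  have e3 : r ^ (-t) * r ^ (N:ℝ) ≤ 1 := by
    rw [← Real.rpow_add r0]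
    exact Real.rpow_le_one_of_one_le_of_nonpos hx (by linarith)
  rw [e1, e2]
  have : r ^ (-t) * r ^ (N:ℝ) * (r ^ (2 - (N:ℝ)) * (1 / 2) ^ (-t) * 8 * I2) ≤
      1 * (r ^ (2 - (N:ℝ)) * (1 / 2) ^ (-t) * 8 * I2) :=
    mul_le_mul_of_nonneg_right e3 (by positivity)
  have : 0 ≤ r ^ (2 - (N:ℝ)) := by positivity
  linarith

/-- First estimate for small `x`. -/
lemma small1 (N : ℕ) (hN : 3 ≤ N) (t : ℝ) (ht : (N:ℝ) < t) :
    ∃ C : ℝ, 0 < C ∧ ∀ x : EuclideanSpace ℝ (Fin N),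
      ∫ y : EuclideanSpace ℝ (Fin N), hh 0 t ‖y‖ * ‖x - y‖ ^ (2 - (N:ℝ)) ≤ C := by
  have hN' : (3:ℝ) ≤ N := by exact_mod_cast hN
  set I1 := ∫ y : EuclideanSpace ℝ (Fin N), hh 0 t ‖y‖ with hI1
  set I2 := ∫ y : EuclideanSpace ℝ (Fin N), hh (N - 2) (N + 1) ‖y‖ with hI2
  have p1 : 0 ≤ I1 := integral_nonneg fun y => hh_nonneg _ _ _ (norm_nonneg _)
  have p2 : 0 ≤ I2 := integral_nonneg fun y => hh_nonneg _ _ _ (norm_nonneg _)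
  refine ⟨I1 + 8 * I2 + 1, by positivity, fun x => ?_⟩
  have hb := combine N hN 0 t (by linarith) ht 1 1 1 8 one_pos one_pos x
    (fun y => hh 0 t ‖y‖ * ‖x - y‖ ^ (2 - (N:ℝ)))
    (fun y => mul_nonneg (hh_nonneg _ _ _ (norm_nonneg _)) (by positivity)) (by
      intro y
      have q1 := hh_nonneg 0 t ‖y‖ (norm_nonneg _)
      have q2 := hh_nonneg (N - 2) (N + 1) (‖x - y‖ / 1) (by positivity)
      rw [div_one] at q2 ⊢
      rw [div_one]
      rcases le_total 1 ‖x - y‖ with h | h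
      · have : ‖x - y‖ ^ (2 - (N:ℝ)) ≤ 1 :=
          Real.rpow_le_one_of_one_le_of_nonpos h (by linarith)
        have := mul_le_mul_of_nonneg_left this q1
        linarith
      · have k1 := near_bound N ‖x - y‖ 1 (norm_nonneg _) one_pos h
        rw [Real.one_rpow, div_one] at k1
        have k2 : hh 0 t ‖y‖ ≤ 1 := by
          rw [hh, neg_zero, Real.rpow_zero, one_mul]
          exact Real.rpow_le_one_of_one_le_of_nonpos (by linarith [norm_nonneg y]) (by linarith)
        have := mul_le_mul k2 k1 (by positivity) (by positivity)
        linarith)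
  refine hb.trans ?_
  rw [← hI1, ← hI2, Real.one_rpow]
  linarith

set_option maxHeartbeats 1000000 in
/-- Second estimate for small `x`. -/
lemma small2 (N : ℕ) (hN : 3 ≤ N) (t θ : ℝ) (ht : (N:ℝ) < t) (hθ : 0 < θ)
    (hθ' : 2 + θ < (N:ℝ)) :
    ∃ C : ℝ, 0 < C ∧ ∀ x : EuclideanSpace ℝ (Fin N), x ≠ 0 →
      ∫ y : EuclideanSpace ℝ (Fin N), hh (θ + 2) t ‖y‖ * ‖x - y‖ ^ (2 - (N:ℝ)) ≤
        C * ‖x‖ ^ (-θ) := by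
  have hN' : (3:ℝ) ≤ N := by exact_mod_cast hN
  set I1 := ∫ y : EuclideanSpace ℝ (Fin N), hh (θ + 2) (N + θ) ‖y‖ with hI1
  set I2 := ∫ y : EuclideanSpace ℝ (Fin N), hh (N - 2) (N + 1) ‖y‖ with hI2
  have p1 : 0 ≤ I1 := integral_nonneg fun y => hh_nonneg _ _ _ (norm_nonneg _)
  have p2 : 0 ≤ I2 := integral_nonneg fun y => hh_nonneg _ _ _ (norm_nonneg _)
  refine ⟨(1 / 5) ^ (2 - (N:ℝ)) * I1 + (1 / 2) ^ (-(θ + 2)) * 8 * I2 + 1, by positivity,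
    fun x hx => ?_⟩
  set r := ‖x‖ with hr
  have r0 : 0 < r := norm_pos_iff.2 hx
  have hb := combine N hN (θ + 2) (N + θ) (by linarith) (by linarith) r r
    ((1 / 5) ^ (2 - (N:ℝ)) * r ^ (-θ - N))
    ((r / 2) ^ (-(θ + 2)) * (8 * r ^ (2 - (N:ℝ)))) r0 r0 x
    (fun y => hh (θ + 2) t ‖y‖ * ‖x - y‖ ^ (2 - (N:ℝ)))
    (fun y => mul_nonneg (hh_nonneg _ _ _ (norm_nonneg _)) (by positivity)) (by
      intro y
      have q1 := hh_nonneg (θ + 2) (N + θ) (‖y‖ / r) (by positivity)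
      have q2 := hh_nonneg (N - 2) (N + 1) (‖x - y‖ / r) (by positivity)
      have q3 : hh (θ + 2) t ‖y‖ ≤ ‖y‖ ^ (-(θ + 2)) := by
        rw [hh]
        refine mul_le_of_le_one_right (by positivity) ?_
        exact Real.rpow_le_one_of_one_le_of_nonpos (by linarith [norm_nonneg y]) (by linarith)
      rcases le_total (r / 2) ‖x - y‖ with h | h
      · have hy : ‖y‖ ≤ ‖x - y‖ + r := by
          have := norm_sub_norm_le y x
          rw [norm_sub_rev y x] at this
          linarith
        have h5 : (r + ‖y‖) * (1 / 5) ≤ ‖x - y‖ := by linarith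
        have k1 : ‖x - y‖ ^ (2 - (N:ℝ)) ≤ ((r + ‖y‖) * (1 / 5)) ^ (2 - (N:ℝ)) :=
          Real.rpow_le_rpow_of_nonpos (by positivity) h5 (by linarith)
        have k2 := mul_le_mul q3 k1 (by positivity) (by positivity)
        have k3 : ‖y‖ ^ (-(θ + 2)) * ((r + ‖y‖) * (1 / 5)) ^ (2 - (N:ℝ)) =
            (1 / 5) ^ (2 - (N:ℝ)) * r ^ (-θ - N) * hh (θ + 2) (N + θ) (‖y‖ / r) := by
          have w1 : ‖y‖ = r * (‖y‖ / r) := by field_simp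
          have w2 : r + ‖y‖ = r * (1 + ‖y‖ / r) := by field_simp
          have w3 : r ^ (-θ - N) = r ^ (-(θ + 2)) * r ^ (2 - (N:ℝ)) := by
            rw [← Real.rpow_add r0]; congr 1; ring
          rw [w2, Real.mul_rpow (by positivity) (by positivity),
            Real.mul_rpow (by positivity) (by positivity), hh,
            show θ + 2 - (N + θ) = 2 - (N:ℝ) by ring, w3]
          have w4 : ‖y‖ ^ (-(θ + 2)) = r ^ (-(θ + 2)) * (‖y‖ / r) ^ (-(θ + 2)) := by
            rw [← Real.mul_rpow (by positivity) (by positivity), ← w1]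
          rw [w4]
          ring
        have : 0 ≤ (r / 2) ^ (-(θ + 2)) * (8 * r ^ (2 - (N:ℝ))) *
            hh (N - 2) (N + 1) (‖x - y‖ / r) := by positivity
        linarith
      · have k1 := near_bound N ‖x - y‖ r (norm_nonneg _) r0 (by linarith)
        have hy : r / 2 ≤ ‖y‖ := by
          have := norm_sub_norm_le x y
          linarith
        have k2 : ‖y‖ ^ (-(θ + 2)) ≤ (r / 2) ^ (-(θ + 2)) :=
          Real.rpow_le_rpow_of_nonpos (by positivity) hy (by linarith)
        have := mul_le_mul (q3.trans k2) k1 (by positivity) (by positivity)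
        have : 0 ≤ (1 / 5) ^ (2 - (N:ℝ)) * r ^ (-θ - N) *
          hh (θ + 2) (N + θ) (‖y‖ / r) := by positivity
        linarith)
  refine hb.trans ?_
  rw [← hI1, ← hI2]
  have e2 : (r / 2) ^ (-(θ + 2)) = r ^ (-(θ + 2)) * (1 / 2) ^ (-(θ + 2)) := by
    rw [← Real.mul_rpow (by positivity) (by positivity)]; congr 1; ring
  have e3 : r ^ (-θ - N) * r ^ (N:ℝ) = r ^ (-θ) := by
    rw [← Real.rpow_add r0]; congr 1; ring
  have e4 : r ^ (-(θ + 2)) * r ^ (2 - (N:ℝ)) * r ^ (N:ℝ) = r ^ (-θ) := by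
    rw [← Real.rpow_add r0, ← Real.rpow_add r0]; congr 1; ring
  rw [e2]
  have : 0 ≤ r ^ (-θ) := by positivity
  calc _ = (1 / 5) ^ (2 - (N:ℝ)) * (r ^ (-θ - N) * r ^ (N:ℝ)) * I1 +
        (1 / 2) ^ (-(θ + 2)) * 8 * (r ^ (-(θ + 2)) * r ^ (2 - (N:ℝ)) * r ^ (N:ℝ)) * I2 := by ring
    _ ≤ _ := by rw [e3, e4]; linarith


/-- estimates for Newtonian potentials of `(1+|y|)^{-τ}` and
`|y|^{-θ-2}(1+|y|)^{-τ+θ+2}`. -/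
theorem statement_6 (N : ℕ) (hN : 3 ≤ N) (τ θ : ℝ) (hτ : (N:ℝ) < τ)
    (hθ : 0 < θ) (hθ' : 2 + θ < (N:ℝ)) :
    ∃ c : ℝ, 0 < c ∧ ∀ x : EuclideanSpace ℝ (Fin N), x ≠ 0 →
      (∫ y : EuclideanSpace ℝ (Fin N),
          (1 + ‖y‖) ^ (-τ) * ‖x - y‖ ^ ((2:ℝ) - (N:ℝ)) ≤ c * (1 + ‖x‖) ^ ((2:ℝ) - (N:ℝ))) ∧
      (∫ y : EuclideanSpace ℝ (Fin N),
          ‖y‖ ^ (-θ - 2) * (1 + ‖y‖) ^ (-τ + θ + 2) * ‖x - y‖ ^ ((2:ℝ) - (N:ℝ)) ≤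
        c * (‖x‖ ^ (-θ) * (1 + ‖x‖) ^ ((2:ℝ) - (N:ℝ) + θ))) := by
  have hN' : (3:ℝ) ≤ N := by exact_mod_cast hN
  obtain ⟨A1, A1p, hA1⟩ := large N hN 0 τ le_rfl (by linarith) hτ
  obtain ⟨A2, A2p, hA2⟩ := large N hN (θ + 2) τ (by linarith) (by linarith) hτ
  obtain ⟨B1, B1p, hB1⟩ := small1 N hN τ hτ
  obtain ⟨B2, B2p, hB2⟩ := small2 N hN τ θ hτ hθ hθ'
  set K : ℝ := (1 / 2) ^ (2 - (N:ℝ)) with hK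
  set L : ℝ := (1 / 2) ^ (2 - (N:ℝ) + θ) with hL
  have Kp : 0 < K := by positivity
  have Lp : 0 < L := by positivity
  have half : ∀ s u e : ℝ, 0 < u → u ≤ 2 * s → e ≤ 0 → s ^ e ≤ (1 / 2) ^ e * u ^ e := by
    intro s u e hu hs he
    rw [← Real.mul_rpow (by positivity) hu.le]
    exact Real.rpow_le_rpow_of_nonpos (by positivity) (by linarith) he
  refine ⟨(A1 + B1) * K + (A2 + B2) * L, by positivity, fun x hx => ?_⟩
  have r0 : 0 < ‖x‖ := norm_pos_iff.2 hx
  have E1 : ∀ y : EuclideanSpace ℝ (Fin N), (1 + ‖y‖) ^ (-τ) = hh 0 τ ‖y‖ := by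
    intro y; simp [hh]
  have E2 : ∀ y : EuclideanSpace ℝ (Fin N),
      ‖y‖ ^ (-θ - 2) * (1 + ‖y‖) ^ (-τ + θ + 2) = hh (θ + 2) τ ‖y‖ := by
    intro y; rw [hh]; congr 2 <;> ring
  simp only [E1, E2]
  set r := ‖x‖ with hr
  have u1 : 0 ≤ (1 + r) ^ (2 - (N:ℝ)) := by positivity
  have u2 : 0 ≤ r ^ (-θ) * (1 + r) ^ (2 - (N:ℝ) + θ) := by positivity
  constructor
  · suffices h : ∫ y : EuclideanSpace ℝ (Fin N), hh 0 τ ‖y‖ * ‖x - y‖ ^ (2 - (N:ℝ)) ≤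
        (A1 + B1) * (K * (1 + r) ^ (2 - (N:ℝ))) by
      have : 0 ≤ (A2 + B2) * L * (1 + r) ^ (2 - (N:ℝ)) := by positivity
      linarith
    rcases le_total 1 r with h | h
    · refine (hA1 x h).trans ?_
      have := half r (1 + r) (2 - N) (by linarith) (by linarith) (by linarith)
      gcongr
      linarith
    · refine (hB1 x).trans ?_
      have := half 1 (1 + r) (2 - N) (by linarith) (by linarith) (by linarith)
      rw [Real.one_rpow] at this
      calc B1 ≤ (A1 + B1) * 1 := by linarith
        _ ≤ _ := by gcongr
  · suffices h : ∫ y : EuclideanSpace ℝ (Fin N), hh (θ + 2) τ ‖y‖ * ‖x - y‖ ^ (2 - (N:ℝ)) ≤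
        (A2 + B2) * (r ^ (-θ) * (L * (1 + r) ^ (2 - (N:ℝ) + θ))) by
      have : 0 ≤ (A1 + B1) * K * (r ^ (-θ) * (1 + r) ^ (2 - (N:ℝ) + θ)) := by positivity
      linarith
    rcases le_total 1 r with h | h
    · refine (hA2 x h).trans ?_
      have := half r (1 + r) (2 - N + θ) (by linarith) (by linarith) (by linarith)
      have e : r ^ (2 - (N:ℝ)) = r ^ (-θ) * r ^ (2 - (N:ℝ) + θ) := by
        rw [← Real.rpow_add r0]; congr 1; ring
      rw [← hr, e]
      gcongr
      linarith
    · refine (hB2 x hx).trans ?_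
      have := half 1 (1 + r) (2 - N + θ) (by linarith) (by linarith) (by linarith)
      rw [Real.one_rpow] at this
      calc B2 * r ^ (-θ) ≤ (A2 + B2) * (r ^ (-θ) * 1) := by
            rw [mul_one]; gcongr; linarith
        _ ≤ _ := by gcongr
end
end

section
/- Let N ≥ 3 be an integer and suppose f ∈ L¹(ℝ^N) is nonnegative and satisfies f(x) ≤ c|x|^{-τ} for |x| > r, for some τ > N, r > 0 and c > 0. Then lim_{|x|→+∞} |x|^{N-2} ∫_{ℝ^N} f(y) |x-y|^{2-N} dy = ∫_{ℝ^N} f(y) dy. -/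
open Real MeasureTheory Filter Metric Set

noncomputable section

lemma aux_radial (N : ℕ) (hN : 3 ≤ N) (R : ℝ) (hR : 0 < R) :
    Integrable (fun z : EuclideanSpace ℝ (Fin N) =>
      (Iio R).indicator (fun t : ℝ => t ^ ((2:ℝ) - (N:ℝ))) ‖z‖) volume ∧
    ∫ z : EuclideanSpace ℝ (Fin N),
      (Iio R).indicator (fun t : ℝ => t ^ ((2:ℝ) - (N:ℝ))) ‖z‖ = sphereArea N * (R ^ 2 / 2) := by
  have : Nonempty (Fin N) := ⟨⟨0, by omega⟩⟩
  have key : ∀ t ∈ Ioi (0:ℝ), t ^ (Module.finrank ℝ (EuclideanSpace ℝ (Fin N)) - 1) •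
      (Iio R).indicator (fun t : ℝ => t ^ ((2:ℝ) - (N:ℝ))) t
        = (Iio R).indicator (fun t : ℝ => t) t := by
    intro t ht
    have ht' : (0:ℝ) < t := ht
    by_cases h : t < R
    · rw [indicator_of_mem (show t ∈ Iio R from h), indicator_of_mem (show t ∈ Iio R from h)]
      simp only [finrank_euclideanSpace, Fintype.card_fin, smul_eq_mul]
      rw [← Real.rpow_natCast, ← Real.rpow_add ht', Nat.cast_sub (by omega)]
      have : ((N:ℝ) - (1:ℕ) + (2 - N)) = 1 := by push_cast; ring
      rw [this, Real.rpow_one]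
    · rw [indicator_of_notMem (show t ∉ Iio R from h), indicator_of_notMem (show t ∉ Iio R from h)]
      simp
  constructor
  · rw [integrable_fun_norm_addHaar volume
      (f := (Iio R).indicator (fun t : ℝ => t ^ ((2:ℝ) - (N:ℝ))))]
    rw [integrableOn_congr_fun key measurableSet_Ioi, IntegrableOn,
      integrable_indicator_iff measurableSet_Iio, IntegrableOn,
      Measure.restrict_restrict measurableSet_Iio, Iio_inter_Ioi]
    exact (continuous_id.integrableOn_Icc (a := 0) (b := R)).mono_set Ioo_subset_Icc_self
  · rw [integral_fun_norm_addHaar volume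
      ((Iio R).indicator (fun t : ℝ => t ^ ((2:ℝ) - (N:ℝ))))]
    rw [setIntegral_congr_fun measurableSet_Ioi key, integral_indicator measurableSet_Iio,
      Measure.restrict_restrict measurableSet_Iio, Iio_inter_Ioi,
      ← integral_Ioc_eq_integral_Ioo, ← intervalIntegral.integral_of_le hR.le, integral_id]
    simp [sphereArea, Measure.real, mul_assoc]

/-- Lemma 2.3, asymptotics of the Newtonian potential at infinity. -/
theorem statement_8 (N : ℕ) (hN : 3 ≤ N) (f : EuclideanSpace ℝ (Fin N) → ℝ)
    (hf_int : Integrable f volume) (hf_nonneg : ∀ x, 0 ≤ f x)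
    (τ r c : ℝ) (hτ : (N:ℝ) < τ) (hr : 0 < r) (hc : 0 < c)
    (hdecay : ∀ x : EuclideanSpace ℝ (Fin N), r < ‖x‖ → f x ≤ c * ‖x‖ ^ (-τ)) :
    Tendsto
      (fun x : EuclideanSpace ℝ (Fin N) =>
        ‖x‖ ^ ((N:ℝ) - 2) * ∫ y : EuclideanSpace ℝ (Fin N), f y * ‖x - y‖ ^ ((2:ℝ) - (N:ℝ)))
      (Filter.comap (fun x => ‖x‖) Filter.atTop)
      (nhds (∫ y : EuclideanSpace ℝ (Fin N), f y)) := by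
  set F : Filter (EuclideanSpace ℝ (Fin N)) := Filter.comap (fun x => ‖x‖) Filter.atTop with hF
  have hnorm : Tendsto (fun x : EuclideanSpace ℝ (Fin N) => ‖x‖) F atTop := tendsto_comap
  have hN' : (3:ℝ) ≤ N := by exact_mod_cast hN
  have hp : (0:ℝ) < (N:ℝ) - 2 := by linarith
  set K : EuclideanSpace ℝ (Fin N) → EuclideanSpace ℝ (Fin N) → ℝ :=
    fun x y => ‖x‖ ^ ((N:ℝ) - 2) * (f y * ‖x - y‖ ^ ((2:ℝ) - (N:ℝ))) with hK
  have hKmeas : ∀ x, AEStronglyMeasurable (K x) volume := by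
    intro x
    refine AEStronglyMeasurable.const_mul (hf_int.aestronglyMeasurable.mul ?_) _
    have : Measurable (fun y : EuclideanSpace ℝ (Fin N) => ‖x - y‖ ^ ((2:ℝ) - (N:ℝ))) := by
      fun_prop
    exact this.aestronglyMeasurable
  have hKnn : ∀ x y, 0 ≤ K x y := fun x y => by
    have := hf_nonneg y
    positivity
  set A : EuclideanSpace ℝ (Fin N) → Set (EuclideanSpace ℝ (Fin N)) :=
    fun x => ball x (‖x‖ / 2) with hA
  have hAm : ∀ x, MeasurableSet (A x) := fun x => measurableSet_ball
  have hAmem : ∀ x y, y ∈ A x ↔ ‖x - y‖ < ‖x‖ / 2 := fun x y => by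
    simp [hA, mem_ball, dist_eq_norm, norm_sub_rev]
  -- far part: pointwise bound
  have hfar_bd : ∀ x, 0 < ‖x‖ → ∀ y, ‖(A x)ᶜ.indicator (K x) y‖ ≤ 2 ^ ((N:ℝ) - 2) * f y := by
    intro x hx y
    have hfy := hf_nonneg y
    by_cases h : y ∈ A x
    · rw [indicator_of_notMem (by simpa using h)]
      simp only [norm_zero]
      positivity
    · rw [indicator_of_mem (by simpa using h), Real.norm_of_nonneg (hKnn x y)]
      rw [hAmem, not_lt] at h
      have h1 : ‖x - y‖ ^ ((2:ℝ) - (N:ℝ)) ≤ (‖x‖ / 2) ^ ((2:ℝ) - (N:ℝ)) :=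
        Real.rpow_le_rpow_of_nonpos (by positivity) h (by linarith)
      have h2 : ‖x‖ ^ ((N:ℝ) - 2) * (‖x‖ / 2) ^ ((2:ℝ) - (N:ℝ)) = 2 ^ ((N:ℝ) - 2) := by
        rw [show (2:ℝ) - N = -((N:ℝ) - 2) by ring, Real.rpow_neg (by positivity),
          Real.div_rpow hx.le (by norm_num)]
        have := Real.rpow_pos_of_pos hx ((N:ℝ) - 2)
        field_simp
      calc K x y = f y * (‖x‖ ^ ((N:ℝ) - 2) * ‖x - y‖ ^ ((2:ℝ) - (N:ℝ))) := by
            simp only [hK]; ring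
        _ ≤ f y * (‖x‖ ^ ((N:ℝ) - 2) * (‖x‖ / 2) ^ ((2:ℝ) - (N:ℝ))) := by gcongr
        _ = 2 ^ ((N:ℝ) - 2) * f y := by rw [h2]; ring
  have hfar_meas : ∀ x, AEStronglyMeasurable ((A x)ᶜ.indicator (K x)) volume :=
    fun x => (hKmeas x).indicator (hAm x).compl
  have hpos : ∀ᶠ x in F, 0 < ‖x‖ := hnorm.eventually_gt_atTop 0
  have hfar_lim : Tendsto (fun x => ∫ y, (A x)ᶜ.indicator (K x) y) F (nhds (∫ y, f y)) := by
    refine tendsto_integral_filter_of_dominated_convergence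
      (fun y => 2 ^ ((N:ℝ) - 2) * f y) (Eventually.of_forall hfar_meas) ?_
      (hf_int.const_mul _) (Eventually.of_forall fun y => ?_)
    · filter_upwards [hpos] with x hx
      exact Eventually.of_forall (hfar_bd x hx)
    · have hq : Tendsto (fun x : EuclideanSpace ℝ (Fin N) => ‖x - y‖ / ‖x‖) F (nhds 1) := by
        rw [tendsto_iff_dist_tendsto_zero]
        have h0 : Tendsto (fun x : EuclideanSpace ℝ (Fin N) => ‖y‖ / ‖x‖) F (nhds 0) :=
          hnorm.const_div_atTop _
        refine squeeze_zero' (Eventually.of_forall fun _ => dist_nonneg) ?_ h0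
        filter_upwards [hpos] with x hx
        have e : ‖x - y‖ / ‖x‖ - 1 = (‖x - y‖ - ‖x‖) / ‖x‖ := by field_simp
        rw [Real.dist_eq, e, abs_div, abs_of_pos hx]
        gcongr
        have := abs_norm_sub_norm_le (x - y) x
        simpa using this
      have hlim : Tendsto (fun x : EuclideanSpace ℝ (Fin N) =>
          f y * (‖x - y‖ / ‖x‖) ^ ((2:ℝ) - (N:ℝ))) F (nhds (f y)) := by
        have := (hq.rpow_const (p := (2:ℝ) - (N:ℝ)) (Or.inl one_ne_zero)).const_mul (f y)
        simpa using this
      refine hlim.congr' ?_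
      filter_upwards [hpos, hq.eventually (lt_mem_nhds (show (1/2:ℝ) < 1 by norm_num))]
        with x hx hx2
      rw [lt_div_iff₀ hx] at hx2
      have hnm : y ∉ A x := by rw [hAmem]; linarith
      rw [indicator_of_mem (by simpa using hnm)]
      simp only [hK]
      rw [Real.div_rpow (norm_nonneg _) hx.le, show (2:ℝ) - N = -((N:ℝ) - 2) by ring,
        Real.rpow_neg hx.le ((N:ℝ) - 2)]
      field_simp
  -- near part
  set G : EuclideanSpace ℝ (Fin N) → EuclideanSpace ℝ (Fin N) → ℝ := fun x y =>
    (‖x‖ ^ ((N:ℝ) - 2) * (c * (‖x‖ / 2) ^ (-τ))) *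
      (Iio (‖x‖ / 2)).indicator (fun t : ℝ => t ^ ((2:ℝ) - (N:ℝ))) ‖x - y‖ with hG
  have hGint : ∀ x, 0 < ‖x‖ → Integrable (G x) volume := fun x hx =>
    ((aux_radial N hN (‖x‖ / 2) (by positivity)).1.comp_sub_left x).const_mul _
  have hGval : ∀ x, 0 < ‖x‖ → ∫ y, G x y =
      (c * 2 ^ τ * (sphereArea N / 8)) * ‖x‖ ^ (-(τ - N)) := by
    intro x hx
    simp only [hG]
    rw [integral_const_mul, integral_sub_left_eq_self (fun z : EuclideanSpace ℝ (Fin N) =>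
      (Iio (‖x‖ / 2)).indicator (fun t : ℝ => t ^ ((2:ℝ) - (N:ℝ))) ‖z‖) volume x,
      (aux_radial N hN (‖x‖ / 2) (by positivity)).2, Real.div_rpow hx.le (by norm_num),
      Real.rpow_neg (by norm_num : (0:ℝ) ≤ 2)]
    have h3 : ‖x‖ ^ (-(τ - N)) = ‖x‖ ^ ((N:ℝ) - 2) * ‖x‖ ^ (-τ) * ‖x‖ ^ 2 := by
      rw [← Real.rpow_natCast ‖x‖ 2, ← Real.rpow_add hx, ← Real.rpow_add hx]
      congr 1
      push_cast; ring
    rw [h3]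
    field_simp
    ring
  have hnear_bd : ∀ x, 2 * r < ‖x‖ → ∀ y, ‖(A x).indicator (K x) y‖ ≤ G x y := by
    intro x hxr y
    have hx : 0 < ‖x‖ := by linarith
    by_cases h : y ∈ A x
    · rw [indicator_of_mem h, Real.norm_of_nonneg (hKnn x y)]
      rw [hAmem] at h
      simp only [hG, hK]
      rw [indicator_of_mem (show ‖x - y‖ ∈ Iio (‖x‖ / 2) from h)]
      have h4 : ‖x‖ / 2 ≤ ‖y‖ := by
        have := norm_sub_norm_le x y
        linarith
      have h5 : f y ≤ c * (‖x‖ / 2) ^ (-τ) := by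
        refine (hdecay y (by linarith)).trans ?_
        exact mul_le_mul_of_nonneg_left
          (Real.rpow_le_rpow_of_nonpos (by positivity) h4 (by linarith)) hc.le
      rw [mul_assoc]
      gcongr
    · rw [indicator_of_notMem h]
      rw [hAmem] at h
      simp only [hG]
      rw [indicator_of_notMem (show ‖x - y‖ ∉ Iio (‖x‖ / 2) from h)]
      simp
  have hbig : ∀ᶠ x in F, 2 * r < ‖x‖ := hnorm.eventually_gt_atTop _
  have hnear_lim : Tendsto (fun x => ∫ y, (A x).indicator (K x) y) F (nhds 0) := by
    have h0 : Tendsto (fun x : EuclideanSpace ℝ (Fin N) =>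
        (c * 2 ^ τ * (sphereArea N / 8)) * ‖x‖ ^ (-(τ - N))) F (nhds 0) := by
      have := ((tendsto_rpow_neg_atTop (sub_pos.2 hτ)).comp hnorm).const_mul
        (c * 2 ^ τ * (sphereArea N / 8))
      simpa using this
    refine squeeze_zero_norm' ?_ h0
    filter_upwards [hpos, hbig] with x hx hxr
    rw [← hGval x hx]
    exact norm_integral_le_of_norm_le (hGint x hx) (Eventually.of_forall (hnear_bd x hxr))
  have hsum := hnear_lim.add hfar_lim
  rw [zero_add] at hsum
  refine hsum.congr' ?_
  filter_upwards [hpos, hbig] with x hx hxr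
  have i1 : Integrable ((A x).indicator (K x)) volume :=
    (hGint x hx).mono' ((hKmeas x).indicator (hAm x)) (Eventually.of_forall (hnear_bd x hxr))
  have i2 : Integrable ((A x)ᶜ.indicator (K x)) volume :=
    (hf_int.const_mul _).mono' (hfar_meas x) (Eventually.of_forall (hfar_bd x hx))
  rw [← integral_add i1 i2, ← integral_const_mul]
  refine integral_congr_ae (Eventually.of_forall fun y => ?_)
  exact congrFun (indicator_self_add_compl (A x) (K x)) y
end
end

section
/- Let N ≥ 3 be an integer and p > N/(N-2) (so that p(N-2) > N). Suppose u ∈ C²(ℝ^N\{0}) is positive, satisfies -Δu(x) = u(x)^p for every x ≠ 0, lim_{|x|→0} u(x)|x|^{2/(p-1)} = c_p, and lim_{|x|→+∞} u(x)|x|^{N-2} = k for some k > 0. Then u^p is integrable on ℝ^N and c_N ∫_{ℝ^N} u(x)^p dx = k, where c_N = 1/((N-2)·σ_{N-1}) and σ_{N-1} is the surface measure of the unit sphere in ℝ^N. -/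
open Real MeasureTheory Filter Metric Set

noncomputable section

open Topology in
lemma aux_ibp {N : ℕ} (w : EuclideanSpace ℝ (Fin N) → ℝ) (hw : ContDiff ℝ 1 w)
    (hc : HasCompactSupport w) (v : EuclideanSpace ℝ (Fin N)) :
    Integrable (fun x => fderiv ℝ w x v) volume ∧ ∫ x, fderiv ℝ w x v = 0 := by
  have h1 : Continuous (fun x => fderiv ℝ w x v) :=
    (hw.continuous_fderiv (by norm_num)).clm_apply continuous_const
  have h2 : HasCompactSupport (fun x => fderiv ℝ w x v) := hc.fderiv_apply ℝ v
  have h3 := h1.integrable_of_hasCompactSupport h2 (μ := volume)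
  refine ⟨h3, ?_⟩
  have := integral_mul_fderiv_eq_neg_fderiv_mul_of_integrable (𝕜 := ℝ) (μ := volume)
    (f := fun _ : EuclideanSpace ℝ (Fin N) => (1:ℝ)) (g := w) (v := v)
    (by simp) (by simpa using h3)
    (by simpa using hw.continuous.integrable_of_hasCompactSupport hc)
    (fun x _ => by fun_prop) (fun x _ => (hw.differentiable (by norm_num)) x)
  simpa using this

open Topology in
lemma aux_green {N : ℕ} (hN : 3 ≤ N) (u φ : EuclideanSpace ℝ (Fin N) → ℝ)
    (hu : ContDiffOn ℝ 2 u {0}ᶜ) (hφ : ContDiff ℝ 2 φ) (hc : HasCompactSupport φ)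
    (h0 : φ =ᶠ[𝓝 0] 0) : ∫ x, (φ x * lap u x - u x * lap φ x) = 0 := by
  have : Nonempty (Fin N) := ⟨⟨0, by omega⟩⟩
  have huA : ∀ x, x ≠ 0 → ContDiffAt ℝ 2 u x := fun x hx =>
    hu.contDiffAt (isOpen_compl_singleton.mem_nhds hx)
  let e : Fin N → EuclideanSpace ℝ (Fin N) := fun i => EuclideanSpace.single i (1:ℝ)
  have hduA : ∀ i x, x ≠ 0 → ContDiffAt ℝ 1 (fun y => fderiv ℝ u y (e i)) x := fun i x hx =>
    ((huA x hx).fderiv_right (m := 1) (by norm_num)).clm_apply contDiffAt_const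
  have hdφ : ∀ i, ContDiff ℝ 1 (fun y => fderiv ℝ φ y (e i)) := fun i =>
    (hφ.fderiv_right (m := 1) (by norm_num)).clm_apply contDiff_const
  let w : Fin N → EuclideanSpace ℝ (Fin N) → ℝ := fun i x =>
    φ x * fderiv ℝ u x (e i) - u x * fderiv ℝ φ x (e i)
  have hw : ∀ i, ContDiff ℝ 1 (w i) := by
    intro i
    rw [contDiff_iff_contDiffAt]
    intro x
    by_cases hx : x = 0
    · subst hx
      have : w i =ᶠ[𝓝 0] fun _ => 0 := by
        filter_upwards [h0, h0.fderiv (𝕜 := ℝ)] with y hy hy'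
        simp [w, hy, hy']
      exact contDiffAt_const.congr_of_eventuallyEq this
    · exact ((hφ.of_le (by norm_num)).contDiffAt.mul (hduA i x hx)).sub
        (((huA x hx).of_le (by norm_num)).mul (hdφ i).contDiffAt)
  have hwc : ∀ i, HasCompactSupport (w i) := fun i =>
    (hc.mul_right (f' := fun x => fderiv ℝ u x (e i))).sub ((hc.fderiv_apply ℝ (e i)).mul_left (f := u))
  have key : ∀ᵐ x : EuclideanSpace ℝ (Fin N), φ x * lap u x - u x * lap φ x
      = ∑ i, fderiv ℝ (w i) x (e i) := by
    have : ∀ᵐ x : EuclideanSpace ℝ (Fin N), x ≠ 0 := by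
      have : Nontrivial (EuclideanSpace ℝ (Fin N)) := inferInstance
      exact Measure.ae_ne volume 0
    filter_upwards [this] with x hx
    have d1 : DifferentiableAt ℝ φ x := (hφ.differentiable (by norm_num)) x
    have d2 : DifferentiableAt ℝ u x := (huA x hx).differentiableAt (by norm_num)
    simp only [lap, Finset.mul_sum, ← Finset.sum_sub_distrib]
    refine Finset.sum_congr rfl fun i _ => ?_
    have d3 := (hduA i x hx).differentiableAt (by norm_num)
    have d4 := ((hdφ i).differentiable (by norm_num)) x
    have := ((d1.hasFDerivAt.mul d3.hasFDerivAt).sub (d2.hasFDerivAt.mul d4.hasFDerivAt)).fderiv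
    have e1 : fderiv ℝ (w i) x = _ := this
    rw [e1]
    simp [e]
    ring
  rw [integral_congr_ae key, integral_finsetSum _ fun i _ => (aux_ibp (w i) (hw i) (hwc i) _).1]
  exact Finset.sum_eq_zero fun i _ => (aux_ibp (w i) (hw i) (hwc i) _).2

/-- Laplacian of a function of the squared norm. -/
lemma aux_lap {N : ℕ} (g : ℝ → ℝ) (hg : ContDiff ℝ 2 g) (s : ℝ) (x : EuclideanSpace ℝ (Fin N)) :
    lap (fun x => g (s * ‖x‖ ^ 2)) x =
      s * (2 * N * deriv g (s * ‖x‖ ^ 2) + 4 * (s * ‖x‖ ^ 2) * deriv (deriv g) (s * ‖x‖ ^ 2)) := by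
  have hn : ∀ y : EuclideanSpace ℝ (Fin N), HasFDerivAt (fun x : EuclideanSpace ℝ (Fin N) => s * ‖x‖ ^ 2)
      (s • (2 • (innerSL ℝ y))) y := fun y => ((hasStrictFDerivAt_norm_sq y).hasFDerivAt.const_mul s)
  have hdg : Differentiable ℝ (deriv g) := by
    have : ContDiff ℝ (1+1) g := hg
    exact ((contDiff_succ_iff_deriv.1 this).2.2).differentiable (by norm_num)
  have h1 : ∀ (y : EuclideanSpace ℝ (Fin N)) i, fderiv ℝ (fun x => g (s * ‖x‖ ^ 2)) y (EuclideanSpace.single i (1:ℝ))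
      = deriv g (s * ‖y‖ ^ 2) * (2 * s * y i) := by
    intro y i
    have := ((hg.differentiable (by norm_num) (s * ‖y‖ ^ 2)).hasDerivAt.comp_hasFDerivAt y (hn y)).fderiv
    have e1 : fderiv ℝ (fun x => g (s * ‖x‖ ^ 2)) y = _ := this
    rw [e1]
    simp only [nsmul_eq_mul, Nat.cast_ofNat, ContinuousLinearMap.smul_apply, innerSL_apply_apply,
      EuclideanSpace.inner_single_right, smul_eq_mul]
    simp
    ring_nf
    simp
  have h2 : ∀ i : Fin N, fderiv ℝ (fun y => fderiv ℝ (fun x => g (s * ‖x‖ ^ 2)) y (EuclideanSpace.single i (1:ℝ))) x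
      (EuclideanSpace.single i (1:ℝ)) = s * (2 * deriv g (s * ‖x‖ ^ 2)) + 4 * s^2 * deriv (deriv g) (s * ‖x‖ ^ 2) * (x i)^2 := by
    intro i
    simp only [h1]
    have a1 := (hdg (s * ‖x‖ ^ 2)).hasDerivAt.comp_hasFDerivAt x (hn x)
    have a2 : HasFDerivAt (fun y : EuclideanSpace ℝ (Fin N) => 2 * s * y i)
      ((2 * s) • (EuclideanSpace.proj i : EuclideanSpace ℝ (Fin N) →L[ℝ] ℝ)) x :=
      (EuclideanSpace.proj i : EuclideanSpace ℝ (Fin N) →L[ℝ] ℝ).hasFDerivAt.const_mul (2 * s)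
    have e1 := (a1.mul a2).fderiv
    have e2 : fderiv ℝ (fun y : EuclideanSpace ℝ (Fin N) => deriv g (s * ‖y‖ ^ 2) * (2 * s * y i)) x = _ := e1
    rw [e2]
    simp [EuclideanSpace.inner_single_right]
    ring
  simp only [lap, h2, Finset.sum_add_distrib, ← Finset.mul_sum]
  rw [EuclideanSpace.norm_sq_eq x]
  simp
  ring

/-- the cutoff profile -/
def gg (t : ℝ) : ℝ := Real.smoothTransition (2 - t)

lemma gg_contDiff {n : ℕ∞} : ContDiff ℝ n gg :=
  Real.smoothTransition.contDiff.comp (contDiff_const.sub contDiff_id)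

lemma gg_one {t : ℝ} (h : t ≤ 1) : gg t = 1 := Real.smoothTransition.one_of_one_le (by linarith)
lemma gg_zero {t : ℝ} (h : 2 ≤ t) : gg t = 0 := Real.smoothTransition.zero_of_nonpos (by linarith)
lemma gg_anti : Antitone gg := fun a b h => Real.smoothTransition.monotone (by linarith)

lemma gg_deriv_contDiff : ContDiff ℝ 1 (deriv gg) := by
    have : ContDiff ℝ (1+1) gg := gg_contDiff (n := 2)
    exact ((contDiff_succ_iff_deriv.1 this).2.2)

lemma gg_deriv2_cont : Continuous (deriv (deriv gg)) := gg_deriv_contDiff.continuous_deriv (by norm_num)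

open Topology in
lemma gg_deriv_zero {t : ℝ} (h : t < 1 ∨ 2 < t) : deriv gg =ᶠ[𝓝 t] 0 := by
  rcases h with h | h
  · have : gg =ᶠ[𝓝 t] fun _ => 1 := by
      filter_upwards [gt_mem_nhds h] with s hs using gg_one hs.le
    have := this.deriv
    simp only [deriv_const'] at this
    exact this
  · have : gg =ᶠ[𝓝 t] fun _ => 0 := by
      filter_upwards [lt_mem_nhds h] with s hs using gg_zero hs.le
    have := this.deriv
    simp only [deriv_const'] at this
    exact this

/-- Laplacian profile -/
def LL (N : ℕ) (t : ℝ) : ℝ := 2 * N * deriv gg t + 4 * t * deriv (deriv gg) t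

lemma LL_cont (N : ℕ) : Continuous (LL N) := by
  have := gg_deriv2_cont
  have := gg_deriv_contDiff.continuous
  unfold LL
  fun_prop

lemma LL_zero (N : ℕ) {t : ℝ} (h : t < 1 ∨ 2 < t) : LL N t = 0 := by
  have h1 := gg_deriv_zero h
  have h2 := h1.deriv.eq_of_nhds
  simp [LL, h1.eq_of_nhds, h2]

/-- the constant -/
lemma aux_const (N : ℕ) (hN : 3 ≤ N) :
    ∫ y : EuclideanSpace ℝ (Fin N), ‖y‖ ^ (-((N:ℝ) - 2)) * LL N (‖y‖ ^ 2) = -(((N:ℝ) - 2) * sphereArea N) := by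
  have : Nonempty (Fin N) := ⟨⟨0, by omega⟩⟩
  rw [integral_fun_norm_addHaar volume (fun r : ℝ => r ^ (-((N:ℝ) - 2)) * LL N (r ^ 2))]
  simp only [finrank_euclideanSpace, Fintype.card_fin, smul_eq_mul, nsmul_eq_mul]
  let F : ℝ → ℝ := fun r => 2 * r ^ 2 * deriv gg (r ^ 2) + (N - 2) * gg (r ^ 2)
  have hF : ContDiff ℝ 1 F := by
    have := gg_deriv_contDiff
    have : ContDiff ℝ 1 gg := gg_contDiff (n := 1)
    simp only [F]
    fun_prop
  have hz : ∀ r : ℝ, 2 < |r| → F r = 0 := by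
    intro r hr
    have : 2 < r ^ 2 := by
      rw [← sq_abs]; nlinarith
    have h1 := (gg_deriv_zero (Or.inr this)).eq_of_nhds
    simp [F, gg_zero this.le, h1]
  have hFc : HasCompactSupport F := by
    apply HasCompactSupport.intro (isCompact_closedBall (0:ℝ) 2)
    intro r hr
    apply hz
    simpa using hr
  have hd : ∀ r : ℝ, deriv F r = r * LL N (r ^ 2) := by
    intro r
    have b0 : HasDerivAt (fun r : ℝ => r ^ 2) (2 * r) r := by simpa using hasDerivAt_pow 2 r
    have b1 := ((gg_contDiff (n := 1)).differentiable (by norm_num) (r^2)).hasDerivAt.comp r b0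
    have b2 := (gg_deriv_contDiff.differentiable (by norm_num) (r^2)).hasDerivAt.comp r b0
    have := (((b0.const_mul 2).mul b2).add (b1.const_mul ((N:ℝ)-2))).deriv
    have e : deriv F r = _ := this
    rw [e]
    simp [LL]
    ring
  have := hFc.integral_Ioi_deriv_eq hF 0
  have e : ∫ y in Ioi (0:ℝ), y ^ (N - 1) * (y ^ (-((N:ℝ) - 2)) * LL N (y ^ 2)) = ∫ y in Ioi (0:ℝ), deriv F y := by
    apply setIntegral_congr_fun measurableSet_Ioi
    intro r hr
    have hr : 0 < r := hr
    simp only [hd]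
    rw [← mul_assoc, ← Real.rpow_natCast, ← Real.rpow_add hr, Nat.cast_sub (by omega)]
    norm_num
  rw [e, this]
  simp only [F, sphereArea, Measure.real]
  rw [gg_one (by norm_num)]
  simp
  ring

lemma lap_sub {N : ℕ} (f g : EuclideanSpace ℝ (Fin N) → ℝ) (hf : ContDiff ℝ 2 f)
    (hg : ContDiff ℝ 2 g) (x : EuclideanSpace ℝ (Fin N)) :
    lap (fun x => f x - g x) x = lap f x - lap g x := by
  have hd : ∀ (f : EuclideanSpace ℝ (Fin N) → ℝ), ContDiff ℝ 2 f → ∀ v,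
      Differentiable ℝ (fun y => fderiv ℝ f y v) := fun f hf v =>
    ((hf.fderiv_right (m := 1) (by norm_num)).clm_apply contDiff_const).differentiable (by norm_num)
  have h1 : ∀ y, fderiv ℝ (fun x => f x - g x) y = fderiv ℝ f y - fderiv ℝ g y := fun y =>
    fderiv_fun_sub (hf.differentiable (by norm_num) y) (hg.differentiable (by norm_num) y)
  simp only [lap, h1, ← Finset.sum_sub_distrib, ContinuousLinearMap.sub_apply]
  refine Finset.sum_congr rfl fun i _ => ?_
  rw [fderiv_fun_sub (hd f hf _ x) (hd g hg _ x)]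
  rfl

open Topology in
lemma aux_int {N : ℕ} (f φ : EuclideanSpace ℝ (Fin N) → ℝ) (hf : ContinuousOn f {0}ᶜ)
    (hφ : Continuous φ) (hc : HasCompactSupport φ) (h0 : φ =ᶠ[𝓝 0] 0) :
    Integrable (fun x => f x * φ x) volume := by
  refine Continuous.integrable_of_hasCompactSupport ?_ (hc.mul_left (f := f))
  rw [continuous_iff_continuousAt]
  intro x
  by_cases hx : x = 0
  · subst hx
    have : (fun x => f x * φ x) =ᶠ[𝓝 0] fun _ => 0 := by
      filter_upwards [h0] with y hy
      simp [hy]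
    exact continuousAt_const.congr this.symm
  · exact (hf.continuousAt (isOpen_compl_singleton.mem_nhds hx)).mul hφ.continuousAt

/-- scaled cutoff -/
def chi {N : ℕ} (r : ℝ) (x : EuclideanSpace ℝ (Fin N)) : ℝ := gg (r⁻¹ ^ 2 * ‖x‖ ^ 2)

lemma chi_contDiff {N : ℕ} (r : ℝ) :
    ContDiff ℝ 2 (chi r : EuclideanSpace ℝ (Fin N) → ℝ) :=
  (gg_contDiff (n := 2)).comp (contDiff_const.mul (contDiff_norm_sq ℝ))

lemma lap_chi {N : ℕ} (r : ℝ) (x : EuclideanSpace ℝ (Fin N)) :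
    lap (chi r) x = r⁻¹ ^ 2 * LL N (r⁻¹ ^ 2 * ‖x‖ ^ 2) :=
  aux_lap gg (gg_contDiff (n := 2)) (r⁻¹ ^ 2) x

lemma chi_one {N : ℕ} {r : ℝ} (hr : 0 < r) {x : EuclideanSpace ℝ (Fin N)} (h : ‖x‖ ≤ r) :
    chi r x = 1 := by
  apply gg_one
  rw [← mul_pow]
  apply pow_le_one₀ (by positivity)
  rw [inv_mul_le_iff₀ hr]; linarith

lemma sq_big {N : ℕ} {r : ℝ} (hr : 0 < r) {x : EuclideanSpace ℝ (Fin N)} (h : 2 * r ≤ ‖x‖) :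
    2 < r⁻¹ ^ 2 * ‖x‖ ^ 2 := by
  rw [← mul_pow]
  have : 2 ≤ r⁻¹ * ‖x‖ := by
    rw [le_inv_mul_iff₀ hr]; linarith
  nlinarith

lemma sq_small {N : ℕ} {r : ℝ} (hr : 0 < r) {x : EuclideanSpace ℝ (Fin N)} (h : ‖x‖ < r) :
    r⁻¹ ^ 2 * ‖x‖ ^ 2 < 1 := by
  rw [← mul_pow]
  apply pow_lt_one₀ (by positivity) _ (by norm_num)
  rw [inv_mul_lt_iff₀ hr]; linarith

lemma chi_zero {N : ℕ} {r : ℝ} (hr : 0 < r) {x : EuclideanSpace ℝ (Fin N)} (h : 2 * r ≤ ‖x‖) :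
    chi r x = 0 := gg_zero (sq_big hr h).le

lemma chi_mono {N : ℕ} {r s : ℝ} (hr : 0 < r) (h : r ≤ s) (x : EuclideanSpace ℝ (Fin N)) :
    chi r x ≤ chi s x := by
  have hs : 0 < s := hr.trans_le h
  apply gg_anti
  gcongr

lemma aux_lapint {N : ℕ} (u : EuclideanSpace ℝ (Fin N) → ℝ) (hu : ContinuousOn u {0}ᶜ) {r : ℝ}
    (hr : 0 < r) : Integrable (fun x => u x * lap (chi r) x) volume := by
  apply aux_int u _ hu
  · have := LL_cont N
    have e : lap (chi r : EuclideanSpace ℝ (Fin N) → ℝ) = fun x => r⁻¹ ^ 2 * LL N (r⁻¹ ^ 2 * ‖x‖ ^ 2) :=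
      funext (lap_chi r)
    rw [e]
    fun_prop
  · apply HasCompactSupport.intro (isCompact_closedBall 0 (2 * r))
    intro x hx
    rw [lap_chi, LL_zero, mul_zero]
    right
    apply sq_big hr
    simp at hx
    exact hx.le
  · filter_upwards [ball_mem_nhds 0 hr] with x hx
    rw [lap_chi, LL_zero, mul_zero]
    · rfl
    left
    apply sq_small hr
    simpa using hx

lemma aux_scale {N : ℕ} (u : EuclideanSpace ℝ (Fin N) → ℝ) {r : ℝ} (hr : 0 < r) :
    ∫ x, u x * lap (chi r) x = ∫ y, r ^ ((N:ℝ) - 2) * u (r • y) * LL N (‖y‖ ^ 2) := by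
  have h := Measure.integral_comp_inv_smul_of_nonneg (volume : Measure (EuclideanSpace ℝ (Fin N)))
    (fun y => u (r • y) * LL N (‖y‖ ^ 2)) hr.le
  have e : ∀ x : EuclideanSpace ℝ (Fin N), u x * lap (chi r) x
      = r⁻¹ ^ 2 * (u (r • (r⁻¹ • x)) * LL N (‖r⁻¹ • x‖ ^ 2)) := by
    intro x
    rw [smul_inv_smul₀ hr.ne', lap_chi, norm_smul, mul_pow, norm_inv, Real.norm_of_nonneg hr.le]
    ring
  simp only [e]
  simp only [mul_assoc]
  rw [integral_const_mul, h, integral_const_mul]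
  simp only [finrank_euclideanSpace, Fintype.card_fin, smul_eq_mul]
  rw [Real.rpow_sub hr, Real.rpow_natCast, Real.rpow_two]
  field_simp

lemma LL_int (N : ℕ) : Integrable (fun y : EuclideanSpace ℝ (Fin N) => LL N (‖y‖ ^ 2)) volume := by
  have := LL_cont N
  apply Continuous.integrable_of_hasCompactSupport (by fun_prop)
  apply HasCompactSupport.intro (isCompact_closedBall 0 2)
  intro x hx
  simp at hx
  rw [LL_zero]
  right; nlinarith

lemma LL_norm {N : ℕ} {y : EuclideanSpace ℝ (Fin N)} (h : LL N (‖y‖ ^ 2) ≠ 0) :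
    1 ≤ ‖y‖ ∧ ‖y‖ ≤ 2 := by
  by_contra hc
  apply h
  apply LL_zero
  by_cases h1 : 1 ≤ ‖y‖
  · right
    have : 2 < ‖y‖ := by
      by_contra h2; exact hc ⟨h1, not_lt.1 h2⟩
    nlinarith
  · left
    have := norm_nonneg y
    nlinarith

open Topology in
/-- General convergence: if `u(x)|x|^a → c` along `|x| = r|y|`, then `r^a u(r y)` integrals converge. -/
lemma aux_conv {N : ℕ} (u : EuclideanSpace ℝ (Fin N) → ℝ) (hu : ContinuousOn u {0}ᶜ)
    (a c : ℝ) (ha : 0 ≤ a) (R : ℕ → ℝ) (hR : ∀ n, 0 < R n)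
    (hlim : ∀ ε > 0, ∀ᶠ n in atTop, ∀ y : EuclideanSpace ℝ (Fin N), 1 ≤ ‖y‖ → ‖y‖ ≤ 2 →
      |u (R n • y) * ‖R n • y‖ ^ a - c| < ε) :
    Tendsto (fun n => ∫ y, R n ^ a * u (R n • y) * LL N (‖y‖ ^ 2)) atTop
      (𝓝 (c * ∫ y : EuclideanSpace ℝ (Fin N), ‖y‖ ^ (-a) * LL N (‖y‖ ^ 2))) := by
  rw [← integral_const_mul]
  have hid : ∀ n (y : EuclideanSpace ℝ (Fin N)), 1 ≤ ‖y‖ →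
      R n ^ a * u (R n • y) = (u (R n • y) * ‖R n • y‖ ^ a) * ‖y‖ ^ (-a) := by
    intro n y hy
    have hy0 : 0 < ‖y‖ := by linarith
    rw [norm_smul, Real.norm_of_nonneg (hR n).le, Real.mul_rpow (hR n).le hy0.le, Real.rpow_neg hy0.le]
    have := (Real.rpow_pos_of_pos hy0 a).ne'
    field_simp
  refine tendsto_integral_filter_of_dominated_convergence
    (fun y => (|c| + 1) * |LL N (‖y‖ ^ 2)|) ?_ ?_ ((LL_int N).abs.const_mul _) ?_
  · refine Eventually.of_forall fun n => ?_
    have h1 : Integrable (fun x => u (R n • x) * LL N (‖x‖ ^ 2)) (volume : Measure (EuclideanSpace ℝ (Fin N))) := by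
      have := LL_cont N
      refine aux_int (fun x => u (R n • x)) _ ?_ (by fun_prop) ?_ ?_
      · apply hu.comp (by fun_prop)
        intro x hx
        simp at hx ⊢
        exact ⟨(hR n).ne', hx⟩
      · apply HasCompactSupport.intro (isCompact_closedBall 0 2)
        intro x hx
        simp at hx
        rw [LL_zero]
        right; nlinarith
      · filter_upwards [ball_mem_nhds 0 one_pos] with x hx
        simp at hx
        rw [LL_zero]
        · rfl
        · left; have := norm_nonneg x; nlinarith
    simp only [mul_assoc]
    exact (h1.const_mul _).aestronglyMeasurable
  · filter_upwards [hlim 1 one_pos] with n hn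
    refine Eventually.of_forall fun y => ?_
    by_cases h : LL N (‖y‖ ^ 2) = 0
    · simp [h]
    obtain ⟨h1, h2⟩ := LL_norm h
    rw [norm_mul, hid n y h1]
    simp only [Real.norm_eq_abs]
    gcongr
    rw [abs_mul]
    have b1 : |u (R n • y) * ‖R n • y‖ ^ a| ≤ |c| + 1 := by
      have := hn y h1 h2
      have := abs_sub_abs_le_abs_sub (u (R n • y) * ‖R n • y‖ ^ a) c
      linarith
    have b2 : |‖y‖ ^ (-a)| ≤ 1 := by
      rw [abs_of_nonneg (by positivity)]
      exact Real.rpow_le_one_of_one_le_of_nonpos h1 (by linarith)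
    calc _ ≤ (|c| + 1) * 1 := by gcongr
      _ = _ := mul_one _
  · refine Eventually.of_forall fun y => ?_
    by_cases h : LL N (‖y‖ ^ 2) = 0
    · simp [h]
    obtain ⟨h1, h2⟩ := LL_norm h
    simp only [hid _ y h1, ← mul_assoc]
    refine Tendsto.mul_const _ (Tendsto.mul_const _ ?_)
    rw [Metric.tendsto_nhds]
    intro ε hε
    filter_upwards [hlim ε hε] with n hn
    exact hn y h1 h2

open Topology in
lemma aux_main (N : ℕ) (hN : 3 ≤ N) (p : ℝ) (hp : (N:ℝ) / ((N:ℝ) - 2) < p)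
    (u : EuclideanSpace ℝ (Fin N) → ℝ) (k : ℝ)
    (hreg : ContDiffOn ℝ 2 u {0}ᶜ)
    (hpos : ∀ x : EuclideanSpace ℝ (Fin N), x ≠ 0 → 0 < u x)
    (heq : ∀ x : EuclideanSpace ℝ (Fin N), x ≠ 0 → -lap u x = u x ^ p)
    (h0 : SingAtOrigin N p u)
    (hinf : Tendsto (fun x : EuclideanSpace ℝ (Fin N) => u x * ‖x‖ ^ ((N:ℝ) - 2))
      (Filter.comap (fun x => ‖x‖) Filter.atTop) (nhds k)) :
    Integrable (fun x : EuclideanSpace ℝ (Fin N) => u x ^ p) volume ∧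
      ∫ x : EuclideanSpace ℝ (Fin N), u x ^ p = k * (((N:ℝ) - 2) * sphereArea N) := by
  have : Nonempty (Fin N) := ⟨⟨0, by omega⟩⟩
  have hN' : (3:ℝ) ≤ N := by exact_mod_cast hN
  have hp1 : 0 < p - 1 ∧ 2 / (p - 1) < (N:ℝ) - 2 := by
    have h2 : (0:ℝ) < (N:ℝ) - 2 := by linarith
    rw [div_lt_iff₀ h2] at hp
    have : 0 < p - 1 := by
      by_contra hc
      nlinarith
    refine ⟨this, ?_⟩
    rw [div_lt_iff₀ this]
    nlinarith
  obtain ⟨hp1, hp2⟩ := hp1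
  have hae : ∀ᵐ x : EuclideanSpace ℝ (Fin N), x ≠ 0 := Measure.ae_ne volume 0
  have hu := hreg.continuousOn
  have hup : ContinuousOn (fun x => u x ^ p) {0}ᶜ :=
    hu.rpow_const fun x hx => Or.inl (hpos x hx).ne'
  let R : ℕ → ℝ := fun n => n + 2
  have hR : ∀ n, 2 ≤ R n := fun n => by simp [R]
  have hR0 : ∀ n, 0 < R n := fun n => by linarith [hR n]
  have hRi : ∀ n, 0 < (R n)⁻¹ := fun n => inv_pos.2 (hR0 n)
  have hRle : ∀ n, (R n)⁻¹ ≤ 1 / 2 := fun n => by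
    rw [inv_le_comm₀ (hR0 n) (by norm_num)]; norm_num; exact hR n
  have hRt : Tendsto R atTop atTop := tendsto_atTop_add_const_right _ _ tendsto_natCast_atTop_atTop
  have hRit : Tendsto (fun n => (R n)⁻¹) atTop (𝓝 0) := tendsto_inv_atTop_zero.comp hRt
  let φ : ℕ → EuclideanSpace ℝ (Fin N) → ℝ := fun n x => chi (R n) x - chi (R n)⁻¹ x
  have hφ : ∀ n, ContDiff ℝ 2 (φ n) := fun n => (chi_contDiff _).sub (chi_contDiff _)
  have hφc : ∀ n, HasCompactSupport (φ n) := by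
    intro n
    apply HasCompactSupport.intro (isCompact_closedBall 0 (2 * R n))
    intro x hx
    simp at hx
    have := hR n
    have := hRle n
    simp only [φ]
    rw [chi_zero (hR0 n) hx.le, chi_zero (hRi n) (by linarith), sub_zero]
  have hφ0 : ∀ n, φ n =ᶠ[𝓝 0] 0 := by
    intro n
    filter_upwards [ball_mem_nhds 0 (hRi n)] with x hx
    simp at hx
    have := hR n
    have := hRle n
    simp only [φ]
    rw [chi_one (hR0 n) (by linarith), chi_one (hRi n) hx.le, sub_self]
    rfl
  -- the two limits
  have lim1 : Tendsto (fun n => ∫ x, u x * lap (chi (R n)) x) atTop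
      (𝓝 (k * -(((N:ℝ) - 2) * sphereArea N))) := by
    simp only [aux_scale u (hR0 _)]
    rw [← aux_const N hN]
    refine aux_conv u hu _ k (by linarith) R hR0 ?_
    intro ε hε
    have := (Metric.tendsto_nhds.1 hinf) ε hε
    rw [eventually_comap] at this
    obtain ⟨b, hb⟩ := eventually_atTop.1 this
    filter_upwards [hRt.eventually_ge_atTop b] with n hn y h1 h2
    refine hb (‖R n • y‖) ?_ _ rfl
    rw [norm_smul, Real.norm_of_nonneg (hR0 n).le]
    nlinarith [hR0 n]
  have lim2 : Tendsto (fun n => ∫ x, u x * lap (chi (R n)⁻¹) x) atTop (𝓝 0) := by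
    have h := aux_conv u hu (2 / (p - 1)) (cp N p) (by positivity) (fun n => (R n)⁻¹) hRi ?_
    · have h3 : Tendsto (fun n => (R n)⁻¹ ^ ((N:ℝ) - 2 - 2 / (p - 1))) atTop (𝓝 0) := by
        have := hRit.rpow_const (p := (N:ℝ) - 2 - 2 / (p - 1)) (Or.inr (by linarith))
        rwa [Real.zero_rpow (by linarith)] at this
      have h4 := h3.mul h
      rw [zero_mul] at h4
      refine h4.congr fun n => ?_
      rw [aux_scale u (hRi n), ← integral_const_mul]
      congr 1
      ext y
      rw [← mul_assoc, ← mul_assoc, ← Real.rpow_add (hRi n)]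
      congr 3
      ring
    · intro ε hε
      have := (Metric.tendsto_nhds.1 h0) ε hε
      rw [eventually_nhdsWithin_iff, Metric.eventually_nhds_iff] at this
      obtain ⟨δ, hδ, hb⟩ := this
      filter_upwards [hRit.eventually (gt_mem_nhds (half_pos hδ))] with n hn y h1 h2
      have hy0 : 0 < ‖y‖ := by linarith
      refine hb ?_ ?_
      · rw [dist_zero_right, norm_smul, Real.norm_of_nonneg (hRi n).le]
        nlinarith [hRi n]
      · simp only [mem_compl_iff, mem_singleton_iff, smul_eq_zero, not_or]
        exact ⟨(hRi n).ne', norm_pos_iff.1 hy0⟩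
  have hint : ∀ n, Integrable (fun x => u x ^ p * φ n x) volume := fun n =>
    aux_int _ _ hup (hφ n).continuous (hφc n) (hφ0 n)
  have hval : ∀ n, ∫ x, u x ^ p * φ n x =
      (∫ x, u x * lap (chi (R n)⁻¹) x) - ∫ x, u x * lap (chi (R n)) x := by
    intro n
    have hg := aux_green hN u (φ n) hreg (hφ n) (hφc n) (hφ0 n)
    have i1 := aux_lapint u hu (hRi n)
    have i2 := aux_lapint u hu (hR0 n)
    rw [← integral_sub i1 i2]
    have i3 : Integrable (fun x => u x * lap (chi (R n)⁻¹) x - u x * lap (chi (R n)) x) volume :=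
      i1.sub i2
    have e : ∀ᵐ x : EuclideanSpace ℝ (Fin N), φ n x * lap u x - u x * lap (φ n) x
        = (u x * lap (chi (R n)⁻¹) x - u x * lap (chi (R n)) x) - u x ^ p * φ n x := by
      filter_upwards [hae] with x hx
      have e1 : lap (φ n) x = _ := lap_sub _ _ (chi_contDiff (R n)) (chi_contDiff (R n)⁻¹) x
      rw [e1, ← heq x hx]
      ring
    rw [integral_congr_ae e, integral_sub i3 (hint n)] at hg
    linarith
  have hlim : Tendsto (fun n => ∫ x, u x ^ p * φ n x) atTop
      (𝓝 (k * (((N:ℝ) - 2) * sphereArea N))) := by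
    simp only [hval]
    have := lim2.sub lim1
    convert this using 2
    ring
  have hφnn : ∀ n x, 0 ≤ φ n x := fun n x =>
    sub_nonneg.2 (chi_mono (hRi n) (by linarith [hR n, hRle n]) x)
  have hmono : ∀ x, Monotone fun n => φ n x := by
    intro x m n hmn
    have h1 : R m ≤ R n := by simp only [R]; gcongr
    have h2 : (R n)⁻¹ ≤ (R m)⁻¹ := inv_anti₀ (hR0 m) h1
    exact sub_le_sub (chi_mono (hR0 m) h1 x) (chi_mono (hRi n) h2 x)
  have hnn : ∀ n, 0 ≤ᵐ[volume] fun x => u x ^ p * φ n x := by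
    intro n
    filter_upwards [hae] with x hx
    exact mul_nonneg (Real.rpow_nonneg (hpos x hx).le _) (hφnn n x)
  have hpt : ∀ᵐ x : EuclideanSpace ℝ (Fin N), Tendsto (fun n => u x ^ p * φ n x) atTop (𝓝 (u x ^ p)) := by
    filter_upwards [hae] with x hx
    have hx' := norm_pos_iff.2 hx
    refine tendsto_const_nhds.congr' ?_
    filter_upwards [hRt.eventually_ge_atTop ‖x‖, hRit.eventually (gt_mem_nhds (half_pos hx'))] with n h1 h2
    simp only [φ]
    rw [chi_one (hR0 n) h1, chi_zero (hRi n) (by linarith)]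
    ring
  have hL := lintegral_tendsto_of_tendsto_of_monotone (μ := volume)
    (f := fun n x => ENNReal.ofReal (u x ^ p * φ n x)) (F := fun x => ENNReal.ofReal (u x ^ p))
    (fun n => (hint n).aestronglyMeasurable.aemeasurable.ennreal_ofReal)
    (by
      filter_upwards [hae] with x hx m n hmn
      exact ENNReal.ofReal_le_ofReal (mul_le_mul_of_nonneg_left (hmono x hmn)
        (Real.rpow_nonneg (hpos x hx).le _)))
    (by
      filter_upwards [hpt] with x hx
      exact ENNReal.tendsto_ofReal hx)
  have hL2 : Tendsto (fun n => ∫⁻ x, ENNReal.ofReal (u x ^ p * φ n x)) atTop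
      (𝓝 (ENNReal.ofReal (k * (((N:ℝ) - 2) * sphereArea N)))) := by
    refine (ENNReal.tendsto_ofReal hlim).congr fun n => ?_
    exact ofReal_integral_eq_lintegral_ofReal (hint n) (hnn n)
  have hE := tendsto_nhds_unique hL hL2
  have hmeas : AEStronglyMeasurable (fun x => u x ^ p) (volume : Measure (EuclideanSpace ℝ (Fin N))) :=
    aestronglyMeasurable_of_tendsto_ae atTop (fun n => (hint n).aestronglyMeasurable) hpt
  have hunn : 0 ≤ᵐ[volume] fun x => u x ^ p := by
    filter_upwards [hae] with x hx
    exact Real.rpow_nonneg (hpos x hx).le _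
  refine ⟨(lintegral_ofReal_ne_top_iff_integrable hmeas hunn).1 (by rw [hE]; exact ENNReal.ofReal_ne_top), ?_⟩
  rw [integral_eq_lintegral_of_nonneg_ae hunn hmeas, hE, ENNReal.toReal_ofReal]
  exact ge_of_tendsto' hlim fun n => integral_nonneg_of_ae (hnn n)

/-- Corollary 2.4, total mass of a `k`-fast decaying solution of the
Lane–Emden equation. -/
theorem statement_9 (N : ℕ) (hN : 3 ≤ N) (p : ℝ) (hp : (N:ℝ) / ((N:ℝ) - 2) < p)
    (u : EuclideanSpace ℝ (Fin N) → ℝ) (k : ℝ) (hk : 0 < k)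
    (hreg : ContDiffOn ℝ 2 u {0}ᶜ)
    (hpos : ∀ x : EuclideanSpace ℝ (Fin N), x ≠ 0 → 0 < u x)
    (heq : ∀ x : EuclideanSpace ℝ (Fin N), x ≠ 0 → -lap u x = u x ^ p)
    (h0 : SingAtOrigin N p u)
    (hinf : Tendsto (fun x : EuclideanSpace ℝ (Fin N) => u x * ‖x‖ ^ ((N:ℝ) - 2))
      (Filter.comap (fun x => ‖x‖) Filter.atTop) (nhds k)) :
    Integrable (fun x : EuclideanSpace ℝ (Fin N) => u x ^ p) volume ∧
      cGreen N * ∫ x : EuclideanSpace ℝ (Fin N), u x ^ p = k := by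
  have hN' : (3:ℝ) ≤ N := by exact_mod_cast hN
  obtain ⟨h1, h2⟩ := aux_main N hN p hp u k hreg hpos heq h0 hinf
  refine ⟨h1, ?_⟩
  have hs : 0 < sphereArea N := by
    unfold sphereArea
    have : 0 < (volume (Metric.ball (0 : EuclideanSpace ℝ (Fin N)) 1)).toReal :=
      ENNReal.toReal_pos (measure_ball_pos _ _ one_pos).ne' measure_ball_lt_top.ne
    positivity
  have h3 : (0:ℝ) < (N:ℝ) - 2 := by linarith
  rw [h2, cGreen]
  field_simp
end
end

section
/- Let N ≥ 3, p ∈ (N/(N-2), p_c), and let V : ℝ^N\{0} → ℝ be locally Hölder continuous, radially symmetric and decreasing with respect to |x|, with 0 ≤ V ≤ 1, |V(x)-1| ≤ c₀|x|^{τ₀} for 0 < |x| ≤ 1 (some c₀ > 0, τ₀ > 0), and (1/γ)|x|^α ≤ V(x) ≤ γ|x|^α for |x| > 1, where γ > 1 and (N-2)p_c - N - 2 < α ≤ 0. Let ν > 0 and let u_ν be a ν-fast decaying solution of -Δu = V u^p on ℝ^N\{0} with lim_{|x|→0} u_ν(x)|x|^{2/(p-1)} = c_p. Then u_ν is radially symmetric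 and decreasing with respect to |x|: u_ν(x) = u_ν(y) whenever |x| = |y| ≠ 0, and u_ν(x) ≥ u_ν(y) whenever 0 < |x| ≤ |y|. -/
open Real MeasureTheory Filter Metric Set

noncomputable section

open Topology Laplacian InnerProductSpace

lemma dd_line {N : ℕ} {f : EuclideanSpace ℝ (Fin N) → ℝ} {x : EuclideanSpace ℝ (Fin N)}
    (hf : ContDiffAt ℝ 2 f x) (v : EuclideanSpace ℝ (Fin N)) :
    iteratedFDeriv ℝ 2 f x ![v, v] = deriv (deriv fun t : ℝ => f (x + t • v)) 0 := by
  have hl : ∀ t : ℝ, HasDerivAt (fun t : ℝ => x + t • v) v t := by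
    intro t
    simpa using ((hasDerivAt_id t).smul_const v).const_add x
  have hc : Tendsto (fun t : ℝ => x + t • v) (𝓝 0) (𝓝 x) := by
    have := (hl 0).continuousAt.tendsto
    simpa using this
  have h1 : ∀ᶠ y in 𝓝 x, ContDiffAt ℝ 2 f y := hf.eventually (by simp)
  have h2 : deriv (fun t : ℝ => f (x + t • v)) =ᶠ[𝓝 0] fun t => fderiv ℝ f (x + t • v) v := by
    filter_upwards [hc.eventually h1] with t ht
    exact ((ht.differentiableAt (by simp)).hasFDerivAt.comp_hasDerivAt t (hl t)).deriv
  rw [h2.deriv_eq, iteratedFDeriv_two_apply]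
  have h3 : DifferentiableAt ℝ (fderiv ℝ f) x :=
    (hf.fderiv_right (m := 1) (by norm_num)).differentiableAt (by simp)
  have h4 : HasDerivAt (fun t : ℝ => fderiv ℝ f (x + t • v)) (fderiv ℝ (fderiv ℝ f) x v) 0 := by
    have h3' : HasFDerivAt (fderiv ℝ f) (fderiv ℝ (fderiv ℝ f) x) (x + (0:ℝ) • v) := by
      simpa using h3.hasFDerivAt
    exact h3'.comp_hasDerivAt (0:ℝ) (hl 0)
  have h5 := h4.clm_apply (hasDerivAt_const (0:ℝ) v)
  simpa using h5.deriv.symm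

lemma lap_eq_laplacian {N : ℕ} {f : EuclideanSpace ℝ (Fin N) → ℝ} {x : EuclideanSpace ℝ (Fin N)}
    (hf : ContDiffAt ℝ 2 f x) : lap f x = Δ f x := by
  rw [laplacian_eq_iteratedFDeriv_orthonormalBasis f (EuclideanSpace.basisFun (Fin N) ℝ)]
  unfold lap
  refine Finset.sum_congr rfl fun i _ => ?_
  rw [iteratedFDeriv_two_apply]
  have h3 : DifferentiableAt ℝ (fderiv ℝ f) x :=
    (hf.fderiv_right (m := 1) (by norm_num)).differentiableAt (by simp)
  have h5 := h3.hasFDerivAt.clm_apply (hasFDerivAt_const (EuclideanSpace.single i (1:ℝ)) x)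
  rw [h5.fderiv]
  simp

/-- Reflection across the hyperplane `⟨e, x⟩ = l`. -/
def rfx {N : ℕ} (e : EuclideanSpace ℝ (Fin N)) (l : ℝ) (x : EuclideanSpace ℝ (Fin N)) :
    EuclideanSpace ℝ (Fin N) := x + (2 * (l - inner ℝ e x)) • e

lemma rfx_eq {N : ℕ} {e : EuclideanSpace ℝ (Fin N)} (he : ‖e‖ = 1) (l : ℝ)
    (x : EuclideanSpace ℝ (Fin N)) :
    rfx e l x = (Submodule.reflection (ℝ ∙ e)ᗮ) x + (2 * l) • e := by
  rw [Submodule.reflection_orthogonal_apply, Submodule.reflection_singleton_apply]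
  simp only [he, rfx]
  simp only [RCLike.ofReal_real_eq_id, id, one_pow, div_one]
  module

lemma laplacian_rfx {N : ℕ} {e : EuclideanSpace ℝ (Fin N)} (he : ‖e‖ = 1) (l : ℝ)
    (f : EuclideanSpace ℝ (Fin N) → ℝ) (x : EuclideanSpace ℝ (Fin N)) :
    Δ (fun y => f (rfx e l y)) x = Δ f (rfx e l x) := by
  set L := Submodule.reflection (ℝ ∙ e)ᗮ with hL
  have h0 : (fun y => f (rfx e l y)) = (fun z => f (z + (2*l) • e)) ∘ L := by
    ext y; simp [rfx_eq he, hL]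
  rw [laplacian_eq_iteratedFDeriv_orthonormalBasis _ (EuclideanSpace.basisFun (Fin N) ℝ),
    laplacian_eq_iteratedFDeriv_orthonormalBasis f ((EuclideanSpace.basisFun (Fin N) ℝ).map L)]
  refine Finset.sum_congr rfl fun i _ => ?_
  rw [h0]
  have h1 := L.toContinuousLinearEquiv.iteratedFDerivWithin_comp_right
    (fun z => f (z + (2*l) • e)) uniqueDiffOn_univ (x := x) (mem_univ _) 2
  simp only [Set.preimage_univ, iteratedFDerivWithin_univ] at h1
  have h2 : ((fun z => f (z + (2*l) • e)) ∘ L) = (fun z => f (z + (2*l) • e)) ∘ L.toContinuousLinearEquiv := rfl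
  rw [h2, h1, iteratedFDeriv_comp_add_right, rfx_eq he]
  simp only [ContinuousMultilinearMap.compContinuousLinearMap_apply]
  congr 1
  ext j
  fin_cases j <;> simp

lemma deriv2_nonneg {g : ℝ → ℝ} (h : IsLocalMin g 0) (hc : ContinuousAt g 0) :
    0 ≤ deriv (deriv g) 0 := by
  by_contra hneg
  push Not at hneg
  have h2 := isLocalMax_of_deriv_deriv_neg hneg h.deriv_eq_zero hc
  have h3 : g =ᶠ[𝓝 0] fun _ => g 0 := by
    filter_upwards [h, h2] with t a b using le_antisymm b a
  have h4 : deriv g =ᶠ[𝓝 0] fun _ => 0 := by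
    have := h3.deriv
    simpa using this
  rw [h4.deriv_eq] at hneg
  simp at hneg

lemma laplacian_nonneg_of_min {N : ℕ} {f : EuclideanSpace ℝ (Fin N) → ℝ}
    {x : EuclideanSpace ℝ (Fin N)} (hf : ContDiffAt ℝ 2 f x) (hm : IsLocalMin f x) :
    0 ≤ Δ f x := by
  rw [laplacian_eq_iteratedFDeriv_orthonormalBasis f (EuclideanSpace.basisFun (Fin N) ℝ)]
  refine Finset.sum_nonneg fun i _ => ?_
  rw [dd_line hf]
  set v := (EuclideanSpace.basisFun (Fin N) ℝ) i
  have hc : ContinuousAt (fun t : ℝ => x + t • v) 0 := by fun_prop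
  have hc' : Tendsto (fun t : ℝ => x + t • v) (𝓝 0) (𝓝 x) := by
    simpa using hc.tendsto
  apply deriv2_nonneg
  · have := hc'.eventually hm
    simpa [IsLocalMin, IsMinFilter] using this
  · have : ContinuousAt f (x + (0:ℝ) • v) := by simpa using hf.continuousAt
    exact ContinuousAt.comp (f := fun t : ℝ => x + t • v) this hc

lemma contDiffAt_normpow {N : ℕ} (s : ℝ) {x : EuclideanSpace ℝ (Fin N)} (hx : x ≠ 0) :
    ContDiffAt ℝ 2 (fun y : EuclideanSpace ℝ (Fin N) => ‖y‖ ^ s) x :=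
  (contDiffAt_norm ℝ hx).rpow_const_of_ne (norm_ne_zero_iff.2 hx)

lemma laplacian_normpow {N : ℕ} (s : ℝ) {x : EuclideanSpace ℝ (Fin N)} (hx : x ≠ 0) :
    Δ (fun y : EuclideanSpace ℝ (Fin N) => ‖y‖ ^ s) x = s * (s + N - 2) * ‖x‖ ^ (s - 2) := by
  rw [laplacian_eq_iteratedFDeriv_orthonormalBasis _ (EuclideanSpace.basisFun (Fin N) ℝ)]
  have hpos : 0 < ‖x‖ := norm_pos_iff.2 hx
  have key : ∀ i : Fin N, iteratedFDeriv ℝ 2 (fun y : EuclideanSpace ℝ (Fin N) => ‖y‖ ^ s) x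
      ![(EuclideanSpace.basisFun (Fin N) ℝ) i, (EuclideanSpace.basisFun (Fin N) ℝ) i]
      = s * (s - 2) * ‖x‖ ^ (s - 4) * (x i) ^ 2 + s * ‖x‖ ^ (s - 2) := by
    intro i
    rw [dd_line (contDiffAt_normpow s hx)]
    set a := ‖x‖ ^ 2 with ha
    have hap : 0 < a := by positivity
    set h : ℝ → ℝ := fun t => a + 2 * t * x i + t ^ 2 with hh
    have e1 : (fun t : ℝ => ‖x + t • (EuclideanSpace.basisFun (Fin N) ℝ) i‖ ^ s)
        = fun t => (h t) ^ (s / 2) := by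
      ext t
      have : h t = ‖x + t • (EuclideanSpace.basisFun (Fin N) ℝ) i‖ ^ 2 := by
        rw [norm_add_sq_real, inner_smul_right, norm_smul]
        simp [hh, ha, EuclideanSpace.inner_single_right]
        ring
      rw [this, ← Real.rpow_natCast, ← Real.rpow_mul (norm_nonneg _)]
      congr 1
      push_cast; ring
    rw [e1]
    have hd : ∀ t, HasDerivAt h (2 * x i + 2 * t) t := by
      intro t
      have := (((hasDerivAt_id t).const_mul 2).mul_const (x i)).const_add a |>.add ((hasDerivAt_id t).pow 2)
      exact HasDerivAt.congr_deriv this (by simp)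
    have h0 : h 0 = a := by simp [hh]
    have hev : ∀ᶠ t in 𝓝 (0:ℝ), 0 < h t := by
      apply (hd 0).continuousAt.eventually_const_lt
      rw [h0]; exact hap
    have h2 : deriv (fun t => (h t) ^ (s/2)) =ᶠ[𝓝 0]
        fun t => (2 * x i + 2 * t) * (s/2) * (h t) ^ (s/2 - 1) := by
      filter_upwards [hev] with t ht
      exact ((hd t).rpow_const (Or.inl ht.ne')).deriv
    rw [h2.deriv_eq]
    have h3 : HasDerivAt (fun t : ℝ => (2 * x i + 2 * t) * (s/2)) s 0 := by
      have := (((hasDerivAt_id (0:ℝ)).const_mul 2).const_add (2 * x i)).mul_const (s/2)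
      exact HasDerivAt.congr_deriv this (by ring)
    have h4 := (hd 0).rpow_const (p := s/2 - 1) (Or.inl (by rw [h0]; exact hap.ne'))
    have h5 := (h3.mul h4).deriv
    have h6 : deriv (fun t => (2 * x i + 2 * t) * (s/2) * (h t) ^ (s/2 - 1)) 0 = _ := h5
    rw [h6, h0]
    have p1 : a ^ (s/2 - 1) = ‖x‖ ^ (s - 2) := by
      rw [ha, ← Real.rpow_natCast, ← Real.rpow_mul (norm_nonneg _)]
      congr 1; push_cast; ring
    have p2 : a ^ (s/2 - 1 - 1) = ‖x‖ ^ (s - 4) := by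
      rw [ha, ← Real.rpow_natCast, ← Real.rpow_mul (norm_nonneg _)]
      congr 1; push_cast; ring
    rw [p1, p2]
    ring
  simp only [key]
  rw [Finset.sum_add_distrib, ← Finset.mul_sum]
  have hs : ∑ i, (x i) ^ 2 = ‖x‖ ^ 2 := by
    rw [EuclideanSpace.norm_sq_eq]; simp
  have p3 : ‖x‖ ^ (s - 2) = ‖x‖ ^ (s - 4) * ‖x‖ ^ 2 := by
    rw [← Real.rpow_natCast, ← Real.rpow_add hpos]
    congr 1; push_cast; ring
  rw [hs, p3]
  simp
  ring

lemma laplacian_add_smul' {N : ℕ} {f g : EuclideanSpace ℝ (Fin N) → ℝ} (c : ℝ)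
    {x : EuclideanSpace ℝ (Fin N)} (hf : ContDiffAt ℝ 2 f x) (hg : ContDiffAt ℝ 2 g x) :
    Δ (f + c • g) x = Δ f x + c * Δ g x := by
  have h : ContDiffAt ℝ 2 (c • g) x := hg.const_smul c
  rw [ContDiffAt.laplacian_add hf h, laplacian_smul _ hg, smul_eq_mul]

section geom
variable {N : ℕ} {e : EuclideanSpace ℝ (Fin N)}

lemma inner_rfx (he : ‖e‖ = 1) (l : ℝ) (x : EuclideanSpace ℝ (Fin N)) :
    inner ℝ e (rfx e l x) = 2 * l - inner ℝ e x := by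
  unfold rfx
  rw [inner_add_right, inner_smul_right, real_inner_self_eq_norm_sq, he]; ring

lemma norm_rfx_sq (he : ‖e‖ = 1) (l : ℝ) (x : EuclideanSpace ℝ (Fin N)) :
    ‖rfx e l x‖ ^ 2 = ‖x‖ ^ 2 + 4 * l * (l - inner ℝ e x) := by
  unfold rfx
  rw [norm_add_sq_real, inner_smul_right, norm_smul, mul_pow, he, real_inner_comm, Real.norm_eq_abs,
    sq_abs]; ring

lemma norm_rfx_le (he : ‖e‖ = 1) {l : ℝ} (hl : 0 ≤ l) {x : EuclideanSpace ℝ (Fin N)}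
    (hx : l ≤ inner ℝ e x) : ‖rfx e l x‖ ≤ ‖x‖ := by
  apply le_of_sq_le_sq _ (norm_nonneg _)
  rw [norm_rfx_sq he]; nlinarith [mul_nonneg hl (sub_nonneg.2 hx)]

lemma norm_rfx_lt (he : ‖e‖ = 1) {l : ℝ} (hl : 0 < l) {x : EuclideanSpace ℝ (Fin N)}
    (hx : l < inner ℝ e x) : ‖rfx e l x‖ < ‖x‖ := by
  apply lt_of_pow_lt_pow_left₀ 2 (norm_nonneg _)
  rw [norm_rfx_sq he]; nlinarith [mul_pos hl (sub_pos.2 hx)]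

lemma rfx_fixed {l : ℝ} {x : EuclideanSpace ℝ (Fin N)}
    (hx : inner ℝ e x = l) : rfx e l x = x := by
  simp [rfx, hx]

lemma rfx_continuous : Continuous (fun z : ℝ × EuclideanSpace ℝ (Fin N) => rfx e z.1 z.2) := by
  unfold rfx; fun_prop

lemma rfx_continuous' (l : ℝ) : Continuous (rfx e l) := by
  unfold rfx; fun_prop

lemma rfx_contDiff (l : ℝ) : ContDiff ℝ 2 (rfx e l) := by
  have h : ContDiff ℝ 2 fun x : EuclideanSpace ℝ (Fin N) => inner ℝ e x :=
    contDiff_const.inner ℝ contDiff_id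
  exact contDiff_id.add ((contDiff_const.mul (contDiff_const.sub h)).smul contDiff_const)

lemma inner_le_norm' (he : ‖e‖ = 1) (x : EuclideanSpace ℝ (Fin N)) : inner ℝ e x ≤ ‖x‖ := by
  simpa [he] using real_inner_le_norm e x

lemma norm_le_norm_rfx (he : ‖e‖ = 1) {l : ℝ} (hl : 0 < l) (x : EuclideanSpace ℝ (Fin N)) :
    ‖x‖ - 2 * l ≤ ‖rfx e l x‖ := by
  rw [rfx_eq he]
  have h1 : ‖(Submodule.reflection (ℝ ∙ e)ᗮ) x‖ = ‖x‖ := LinearIsometryEquiv.norm_map _ _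
  have h2 : ‖(2 * l) • e‖ = 2 * l := by
    rw [norm_smul, he, Real.norm_of_nonneg (by linarith)]; ring
  have h3 := norm_sub_norm_le ((Submodule.reflection (ℝ ∙ e)ᗮ) x) (-((2 * l) • e))
  rw [norm_neg, sub_neg_eq_add, h1, h2] at h3
  exact h3

lemma maxprinc (hN : 3 ≤ N) (he : ‖e‖ = 1) {l ρ : ℝ} (hl : 0 < l) (hρ : 0 < ρ)
    {U : EuclideanSpace ℝ (Fin N) → ℝ} (hU : ∀ x, x ≠ 0 → ContDiffAt ℝ 2 U x)
    (hinf : ∀ ε > 0, ∃ R, ∀ y, R ≤ ‖y‖ → 0 ≤ U y ∧ U y * ‖y‖ ^ (((N:ℝ) - 2) / 2) ≤ ε)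
    (hneg : ∀ x, l < inner ℝ e x → ρ ≤ ‖rfx e l x‖ → U (rfx e l x) < U x →
      ρ < ‖rfx e l x‖ ∧ Δ U (rfx e l x) - Δ U x <
        (((N:ℝ) - 2) / 2) ^ 2 / ‖x‖ ^ 2 * (U x - U (rfx e l x))) :
    ∀ x, l ≤ inner ℝ e x → ρ ≤ ‖rfx e l x‖ → U x ≤ U (rfx e l x) := by
  intro x1 hx1 hx1'
  by_contra hcon
  push Not at hcon
  set q : ℝ := ((N:ℝ) - 2) / 2 with hq
  set D : Set (EuclideanSpace ℝ (Fin N)) := {x | l ≤ inner ℝ e x ∧ ρ ≤ ‖rfx e l x‖} with hD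
  have hDcl : IsClosed D := by
    have c1 : Continuous fun x : EuclideanSpace ℝ (Fin N) => inner ℝ e x := by fun_prop
    exact (isClosed_le continuous_const c1).inter
      (isClosed_le continuous_const (rfx_continuous' l).norm)
  have hDpos : ∀ x ∈ D, 0 < ‖x‖ := fun x hx =>
    lt_of_lt_of_le hl (hx.1.trans (inner_le_norm' he x))
  have hDne : ∀ x ∈ D, x ≠ 0 := fun x hx => norm_pos_iff.1 (hDpos x hx)
  have hDne' : ∀ x ∈ D, rfx e l x ≠ 0 := fun x hx => norm_pos_iff.1 (hρ.trans_le hx.2)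
  set w : EuclideanSpace ℝ (Fin N) → ℝ := fun x => U (rfx e l x) - U x with hw
  have hwC : ∀ x ∈ D, ContDiffAt ℝ 2 w x := fun x hx =>
    ((hU _ (hDne' x hx)).comp x (rfx_contDiff l).contDiffAt).sub (hU x (hDne x hx))
  have hfc : ContinuousOn (fun x => w x * ‖x‖ ^ q) D := by
    intro x hx
    apply ContinuousAt.continuousWithinAt
    exact (hwC x hx).continuousAt.mul
      (continuous_norm.continuousAt.rpow_const (Or.inl (hDpos x hx).ne'))
  have hx1D : x1 ∈ D := ⟨hx1, hx1'⟩
  have hw1 : w x1 < 0 := by simp only [hw]; linarith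
  have hf1 : w x1 * ‖x1‖ ^ q < 0 := mul_neg_of_neg_of_pos hw1 (Real.rpow_pos_of_pos (hDpos x1 hx1D) q)
  obtain ⟨R, hR⟩ := hinf (-(w x1 * ‖x1‖ ^ q)) (by linarith)
  have hev : ∀ᶠ x in cocompact (EuclideanSpace ℝ (Fin N)) ⊓ 𝓟 D,
      w x1 * ‖x1‖ ^ q ≤ w x * ‖x‖ ^ q := by
    apply Filter.Eventually.filter_mono inf_le_left
    filter_upwards [(tendsto_norm_cocompact_atTop (E := EuclideanSpace ℝ (Fin N))).eventually_ge_atTop (R + 2 * l)]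
      with x hx
    have a1 := hR x (by linarith)
    have a2 := (hR (rfx e l x) (by linarith [norm_le_norm_rfx he hl x])).1
    have a3 : 0 ≤ ‖x‖ ^ q := Real.rpow_nonneg (norm_nonneg _) _
    have a4 : w x * ‖x‖ ^ q = U (rfx e l x) * ‖x‖ ^ q - U x * ‖x‖ ^ q := by simp only [hw]; ring
    rw [a4]
    nlinarith [mul_nonneg a2 a3, a1.2]
  obtain ⟨x0, hx0D, hmin⟩ := hfc.exists_isMinOn' hDcl hx1D hev
  set t := w x0 * ‖x0‖ ^ q with ht
  have htneg : t < 0 := lt_of_le_of_lt (hmin hx1D) hf1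
  have hx0pos := hDpos x0 hx0D
  have hw0 : w x0 = t * ‖x0‖ ^ (-q) := by
    rw [ht, mul_assoc, ← Real.rpow_add hx0pos]; simp
  have hw0neg : w x0 < 0 := by
    rw [hw0]; exact mul_neg_of_neg_of_pos htneg (Real.rpow_pos_of_pos hx0pos _)
  have hin : l < inner ℝ e x0 := by
    rcases lt_or_eq_of_le hx0D.1 with h | h
    · exact h
    · exfalso
      have : w x0 = 0 := by simp only [hw]; rw [rfx_fixed h.symm]; ring
      linarith
  obtain ⟨hρ0, hlap⟩ := hneg x0 hin hx0D.2 (by simp only [hw] at hw0neg; linarith)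
  have hDn : ∀ᶠ x in 𝓝 x0, x ∈ D := by
    have c1 : Continuous fun x : EuclideanSpace ℝ (Fin N) => inner ℝ e x := by fun_prop
    have c2 : Continuous fun x => ‖rfx e l x‖ := (rfx_continuous' l).norm
    filter_upwards [c1.continuousAt.eventually_const_lt hin,
      c2.continuousAt.eventually_const_lt hρ0] with x h1 h2
    exact ⟨h1.le, h2.le⟩
  set φ : EuclideanSpace ℝ (Fin N) → ℝ := fun y => ‖y‖ ^ (-q) with hφ
  have hφC : ContDiffAt ℝ 2 φ x0 := contDiffAt_normpow _ (hDne x0 hx0D)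
  have hF : IsLocalMin (w - t • φ) x0 := by
    filter_upwards [hDn] with x hx
    have h1 : t ≤ w x * ‖x‖ ^ q := hmin hx
    have hxp := hDpos x hx
    have h2 : t * ‖x‖ ^ (-q) ≤ w x := by
      have h3 := mul_le_mul_of_nonneg_right h1 (Real.rpow_nonneg (norm_nonneg x) (-q))
      rwa [mul_assoc (w x), ← Real.rpow_add hxp, add_neg_cancel, Real.rpow_zero, mul_one] at h3
    simp only [Pi.sub_apply, Pi.smul_apply, smul_eq_mul, hφ]
    linarith
  have hFC : ContDiffAt ℝ 2 (w - t • φ) x0 := (hwC x0 hx0D).sub (hφC.const_smul t)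
  have h0 := laplacian_nonneg_of_min hFC hF
  have e0 : w - t • φ = w + (-t) • φ := by ext; simp; ring
  have e1 : w = (fun y => U (rfx e l y)) + (-1 : ℝ) • U := by ext; simp [hw]; ring
  have hUr : ContDiffAt ℝ 2 (fun y => U (rfx e l y)) x0 :=
    (hU _ (hDne' x0 hx0D)).comp x0 (rfx_contDiff l).contDiffAt
  have hU0 := hU x0 (hDne x0 hx0D)
  have e2 : Δ w x0 = Δ U (rfx e l x0) - Δ U x0 := by
    rw [e1, laplacian_add_smul' _ hUr hU0, laplacian_rfx he]
    ring
  rw [e0, laplacian_add_smul' _ (hwC x0 hx0D) hφC, e2] at h0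
  have e3 : Δ φ x0 = - (q ^ 2 / ‖x0‖ ^ 2 * ‖x0‖ ^ (-q)) := by
    rw [hφ, laplacian_normpow _ (hDne x0 hx0D)]
    rw [Real.rpow_sub hx0pos]
    have : ((N:ℝ) - 2) = 2 * q := by rw [hq]; ring
    have h7 : -q + (N:ℝ) - 2 = q := by linarith
    rw [h7]
    simp
    ring
  rw [e3] at h0
  have e4 : U x0 - U (rfx e l x0) = - (t * ‖x0‖ ^ (-q)) := by rw [← hw0]; simp only [hw]; ring
  rw [e4] at hlap
  nlinarith

end geom

/-- Comparison function `u - c |x|^{2-N}`. -/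
abbrev Uc {N : ℕ} (u : EuclideanSpace ℝ (Fin N) → ℝ) (c : ℝ) : EuclideanSpace ℝ (Fin N) → ℝ :=
  u + (-c) • fun z : EuclideanSpace ℝ (Fin N) => ‖z‖ ^ (2 - (N:ℝ))

/-- Working data for the moving plane argument. -/
structure MPCore (N : ℕ) (p ν : ℝ) (V u : EuclideanSpace ℝ (Fin N) → ℝ) : Prop where
  hN : 3 ≤ N
  hp : 1 < p
  hν : 0 < ν
  hC : ∀ x, x ≠ 0 → ContDiffAt ℝ 2 u x
  hpos : ∀ x, x ≠ 0 → 0 < u x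
  hlap : ∀ x, x ≠ 0 → Δ u x = -(V x * u x ^ p)
  hV0 : ∀ x, x ≠ 0 → 0 ≤ V x
  hV1 : ∀ x, x ≠ 0 → V x ≤ 1
  hVd : ∀ x y : EuclideanSpace ℝ (Fin N), x ≠ 0 → ‖x‖ ≤ ‖y‖ → V y ≤ V x
  hbdd : ∀ r > 0, ∃ M, ∀ x, r ≤ ‖x‖ → u x ≤ M
  hsing : ∀ M : ℝ, ∃ ρ > 0, ∀ x, x ≠ 0 → ‖x‖ ≤ ρ → M < u x
  hinf : ∀ c, 0 ≤ c → c < ν → ∀ ε > 0, ∃ R, ∀ y, R ≤ ‖y‖ →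
    0 ≤ (Uc u c) y ∧
    (Uc u c) y * ‖y‖ ^ (((N:ℝ) - 2) / 2) ≤ ε
  hfar : ∃ R0 : ℝ, ∀ x, R0 < ‖x‖ → p * u x ^ (p - 1) < (((N:ℝ) - 2) / 2) ^ 2 / ‖x‖ ^ 2

lemma pow_diff_le {p a b : ℝ} (hp : 1 < p) (hb : 0 < b) (hab : b ≤ a) :
    a ^ p - b ^ p ≤ p * a ^ (p - 1) * (a - b) := by
  have ha : 0 < a := hb.trans_le hab
  have hq : 0 < b / a := by positivity
  have h1 := one_add_mul_self_le_rpow_one_add (s := b / a - 1) (by linarith) hp.le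
  rw [add_sub_cancel, Real.div_rpow hb.le ha.le] at h1
  have hap : 0 < a ^ p := Real.rpow_pos_of_pos ha _
  have h2 : a ^ p = a ^ (p - 1) * a := by
    rw [← Real.rpow_add_one ha.ne']; congr 1; ring
  rw [le_div_iff₀ hap] at h1
  have h3 : (1 + p * (b / a - 1)) * a ^ p = a ^ p - p * a ^ (p-1) * (a - b) := by
    rw [h2]; field_simp; ring
  linarith

/-- The moving plane inequality at position `l`. -/
def PP {N : ℕ} (u : EuclideanSpace ℝ (Fin N) → ℝ) (e : EuclideanSpace ℝ (Fin N)) (l : ℝ) : Prop :=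
  ∀ x, l ≤ inner ℝ e x → rfx e l x ≠ 0 → u x ≤ u (rfx e l x)

section core
variable {N : ℕ} {p ν : ℝ} {V u : EuclideanSpace ℝ (Fin N) → ℝ} {e : EuclideanSpace ℝ (Fin N)}

lemma ne_zero_of_inner {l : ℝ} (hl : 0 < l) {x : EuclideanSpace ℝ (Fin N)}
    (hx : l ≤ inner ℝ e x) : x ≠ 0 := by
  rintro rfl; simp at hx; linarith

lemma MPCore.lapdiff (H : MPCore N p ν V u) (he : ‖e‖ = 1) {l : ℝ} (hl : 0 < l)
    {x : EuclideanSpace ℝ (Fin N)} (hx : l ≤ inner ℝ e x) (hr : rfx e l x ≠ 0) :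
    Δ u (rfx e l x) - Δ u x ≤ V x * (u x ^ p - u (rfx e l x) ^ p) := by
  have hx0 := ne_zero_of_inner hl hx
  rw [H.hlap _ hr, H.hlap _ hx0]
  have h1 := H.hVd _ _ hr (norm_rfx_le he hl.le hx)
  have h2 : 0 ≤ u (rfx e l x) ^ p := Real.rpow_nonneg (H.hpos _ hr).le _
  nlinarith [mul_le_mul_of_nonneg_right h1 h2]

/-- Uniform control near the reflected singularity. -/
lemma MPCore.near (H : MPCore N p ν V u) (he : ‖e‖ = 1) {r : ℝ} (hr : 0 < r) :
    ∃ ρ > 0, ρ < r ∧ ∀ l, r ≤ l → ∀ x, l ≤ inner ℝ e x → rfx e l x ≠ 0 → ‖rfx e l x‖ ≤ ρ →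
      u x + 1 < u (rfx e l x) := by
  obtain ⟨M, hM⟩ := H.hbdd r hr
  obtain ⟨ρ, hρ, h⟩ := H.hsing (M + 1)
  refine ⟨min ρ (r/2), by positivity, (min_le_right _ _).trans_lt (by linarith), ?_⟩
  intro l hl x hx h0 hn
  have h1 := hM x (hl.trans (hx.trans (inner_le_norm' he x)))
  have h2 := h _ h0 (hn.trans (min_le_left _ _))
  linarith

lemma MPCore.start (H : MPCore N p ν V u) : ∃ R0 : ℝ, ∀ e : EuclideanSpace ℝ (Fin N), ‖e‖ = 1 → ∀ l > 0,
    (∀ x, ‖x‖ ≤ R0 → l ≤ inner ℝ e x → rfx e l x ≠ 0 → u x ≤ u (rfx e l x)) → PP u e l := by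
  obtain ⟨R0, hR0⟩ := H.hfar
  refine ⟨R0, fun e he l hl hin => ?_⟩
  obtain ⟨ρ, hρ, hρl, hnear⟩ := H.near he hl
  have key := maxprinc H.hN he hl hρ (U := u) H.hC (by
    intro ε hε
    obtain ⟨R, hR⟩ := H.hinf 0 le_rfl H.hν ε hε
    exact ⟨R, fun y hy => by simpa using hR y hy⟩) (by
    intro x hx hxρ hlt
    have hr : rfx e l x ≠ 0 := norm_pos_iff.1 (hρ.trans_le hxρ)
    have hx0 := ne_zero_of_inner hl hx.le
    constructor
    · rcases lt_or_eq_of_le hxρ with h | h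
      · exact h
      · have := hnear l le_rfl x hx.le hr h.ge
        linarith
    · have hbig : R0 < ‖x‖ := by
        by_contra hc
        push Not at hc
        linarith [hin x hc hx.le hr]
      have h1 := H.lapdiff he hl hx.le hr
      have h2 := pow_diff_le H.hp (H.hpos _ hr) hlt.le
      have h3 := hR0 x hbig
      have h4 := H.hV0 x hx0
      have h5 := H.hV1 x hx0
      have h6 : 0 ≤ u x ^ p - u (rfx e l x) ^ p := by
        have := Real.rpow_le_rpow (H.hpos _ hr).le hlt.le (by linarith [H.hp] : 0 ≤ p)
        linarith
      have h7 : V x * (u x ^ p - u (rfx e l x) ^ p) ≤ 1 * (u x ^ p - u (rfx e l x) ^ p) :=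
        mul_le_mul_of_nonneg_right h5 h6
      have h8 := mul_lt_mul_of_pos_right h3 (sub_pos.2 hlt)
      linarith)
  intro x hx hr
  rcases le_total ρ ‖rfx e l x‖ with h | h
  · exact key x hx h
  · linarith [hnear l le_rfl x hx hr h]

/-- Comparison with the half-space Green function: strong maximum principle and Hopf lemma. -/
lemma MPCore.green (H : MPCore N p ν V u) (he : ‖e‖ = 1) {l ρ : ℝ} (hl : 0 < l) (hρ : 0 < ρ)
    (hP : PP u e l)
    (hnear : ∀ x, l ≤ inner ℝ e x → rfx e l x ≠ 0 → ‖rfx e l x‖ ≤ ρ → u x + 1 < u (rfx e l x)) :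
    ∃ c > 0, ∀ x, l ≤ inner ℝ e x → ρ ≤ ‖rfx e l x‖ →
      (Uc u c) x ≤
        (Uc u c) (rfx e l x) := by
  have hN3 : (3:ℝ) ≤ N := by exact_mod_cast H.hN
  have hρN : 0 < ρ ^ ((N:ℝ) - 2) := Real.rpow_pos_of_pos hρ _
  set c := min (ν / 2) (ρ ^ ((N:ℝ) - 2)) with hc
  have hcpos : 0 < c := lt_min (by linarith [H.hν]) hρN
  have hΦC : ∀ x : EuclideanSpace ℝ (Fin N), x ≠ 0 →
      ContDiffAt ℝ 2 (fun z : EuclideanSpace ℝ (Fin N) => ‖z‖ ^ (2 - (N:ℝ))) x :=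
    fun x hx => contDiffAt_normpow _ hx
  have hΔ : ∀ x : EuclideanSpace ℝ (Fin N), x ≠ 0 →
      Δ (Uc u c) x = Δ u x := by
    intro x hx
    rw [laplacian_add_smul' _ (H.hC x hx) (hΦC x hx), laplacian_normpow _ hx]
    have : (2 - (N:ℝ) + N - 2) = 0 := by ring
    rw [this]; ring
  refine ⟨c, hcpos, ?_⟩
  apply maxprinc H.hN he hl hρ
  · intro x hx
    have : ContDiffAt ℝ 2 ((-c) • fun z : EuclideanSpace ℝ (Fin N) => ‖z‖ ^ (2 - (N:ℝ))) x :=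
      (hΦC x hx).const_smul (-c)
    exact (H.hC x hx).add this
  · exact H.hinf c hcpos.le ((min_le_left _ _).trans_lt (by linarith [H.hν]))
  · intro x hx hxρ hlt
    have hr : rfx e l x ≠ 0 := norm_pos_iff.1 (hρ.trans_le hxρ)
    have hx0 := ne_zero_of_inner hl hx.le
    constructor
    · rcases lt_or_eq_of_le hxρ with h | h
      · exact h
      · exfalso
        have h1 := hnear x hx.le hr h.ge
        simp only [Pi.add_apply, Pi.smul_apply, smul_eq_mul] at hlt
        have h2 : c * ‖rfx e l x‖ ^ (2 - (N:ℝ)) ≤ 1 := by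
          rw [← h]
          calc c * ρ ^ (2 - (N:ℝ)) ≤ ρ ^ ((N:ℝ) - 2) * ρ ^ (2 - (N:ℝ)) :=
                mul_le_mul_of_nonneg_right (min_le_right _ _) (Real.rpow_nonneg hρ.le _)
            _ = 1 := by rw [← Real.rpow_add hρ]; simp
        have h3 : 0 ≤ c * ‖x‖ ^ (2 - (N:ℝ)) :=
          mul_nonneg hcpos.le (Real.rpow_nonneg (norm_nonneg _) _)
        linarith
    · rw [hΔ _ hr, hΔ _ hx0]
      have h1 := H.lapdiff he hl hx.le hr
      have h2 := hP x hx.le hr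
      have h3 := Real.rpow_le_rpow (H.hpos _ hx0).le h2 (by linarith [H.hp] : 0 ≤ p)
      have h4 := H.hV0 x hx0
      have h5 : V x * (u x ^ p - u (rfx e l x) ^ p) ≤ 0 :=
        mul_nonpos_of_nonneg_of_nonpos h4 (by linarith)
      have hxn : 0 < ‖x‖ := norm_pos_iff.2 hx0
      have h6 : 0 < (((N:ℝ) - 2) / 2) ^ 2 / ‖x‖ ^ 2 := by
        have : 0 < (N:ℝ) - 2 := by linarith
        positivity
      have h7 := mul_pos h6 (sub_pos.2 hlt)
      linarith

lemma rfx_add_smul (he : ‖e‖ = 1) {l : ℝ} {x : EuclideanSpace ℝ (Fin N)} (hx : inner ℝ e x = l)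
    (t : ℝ) : rfx e l (x + t • e) = x - t • e := by
  unfold rfx
  rw [inner_add_right, inner_smul_right, real_inner_self_eq_norm_sq, he, hx]
  module

/-- Sign of the normal derivative on the plane. -/
lemma MPCore.hopf (H : MPCore N p ν V u) (he : ‖e‖ = 1) {l ρ c : ℝ} (hl : 0 < l) (hρl : ρ < l)
    (hc : 0 < c) (hg : ∀ x, l ≤ inner ℝ e x → ρ ≤ ‖rfx e l x‖ →
      (Uc u c) x ≤
        (Uc u c) (rfx e l x))
    {x : EuclideanSpace ℝ (Fin N)} (hx : inner ℝ e x = l) : fderiv ℝ u x e < 0 := by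
  have hN3 : (3:ℝ) ≤ N := by exact_mod_cast H.hN
  have hx0 : x ≠ 0 := ne_zero_of_inner hl hx.ge
  have hxn : 0 < ‖x‖ := norm_pos_iff.2 hx0
  have hlx : l ≤ ‖x‖ := hx ▸ inner_le_norm' he x
  set U := (Uc u c) with hU
  have hu := ((H.hC x hx0).differentiableAt (by simp)).hasFDerivAt
  -- line derivatives
  have hline : ∀ s : ℝ, HasDerivAt (fun t : ℝ => x + (s * t) • e) (s • e) 0 := by
    intro s
    have := (((hasDerivAt_id (0:ℝ)).const_mul s).smul_const e).const_add x
    simpa using this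
  have hul : ∀ s : ℝ, HasDerivAt (fun t : ℝ => u (x + (s * t) • e)) (s * fderiv ℝ u x e) 0 := by
    intro s
    have hu' : HasFDerivAt u (fderiv ℝ u x) (x + (s * 0) • e) := by simpa using hu
    have := hu'.comp_hasDerivAt (0:ℝ) (hline s)
    exact HasDerivAt.congr_deriv this (by simp)
  have hΦ : ∀ s : ℝ, HasDerivAt (fun t : ℝ => ‖x + (s * t) • e‖ ^ (2 - (N:ℝ)))
      (s * ((2 - (N:ℝ)) * l * ‖x‖ ^ (-(N:ℝ)))) 0 := by
    intro s
    have e1 : (fun t : ℝ => ‖x + (s * t) • e‖ ^ (2 - (N:ℝ)))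
        = fun t => (‖x‖ ^ 2 + 2 * (s * t) * l + (s * t) ^ 2) ^ ((2 - (N:ℝ)) / 2) := by
      ext t
      have : ‖x‖ ^ 2 + 2 * (s * t) * l + (s * t) ^ 2 = ‖x + (s * t) • e‖ ^ 2 := by
        rw [norm_add_sq_real, inner_smul_right, norm_smul, real_inner_comm, hx, he,
          Real.norm_eq_abs, mul_one, sq_abs]
        ring
      rw [this, ← Real.rpow_natCast, ← Real.rpow_mul (norm_nonneg _)]
      congr 1
      push_cast; ring
    rw [e1]
    have hst : HasDerivAt (fun t : ℝ => s * t) s 0 := by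
      simpa using (hasDerivAt_id (0:ℝ)).const_mul s
    have hd : HasDerivAt (fun t : ℝ => ‖x‖ ^ 2 + 2 * (s * t) * l + (s * t) ^ 2) (2 * s * l) 0 := by
      have := (((hst.const_mul 2).mul_const l).const_add (‖x‖ ^ 2)).add (hst.pow 2)
      exact HasDerivAt.congr_deriv this (by simp)
    have := hd.rpow_const (p := (2 - (N:ℝ)) / 2) (Or.inl (by simp; exact hx0))
    refine HasDerivAt.congr_deriv this ?_
    have p1 : (‖x‖ ^ 2 + 2 * (s * 0) * l + (s * 0) ^ 2) ^ ((2 - (N:ℝ)) / 2 - 1) = ‖x‖ ^ (-(N:ℝ)) := by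
      have : ‖x‖ ^ 2 + 2 * (s * 0) * l + (s * 0) ^ 2 = ‖x‖ ^ 2 := by ring
      rw [this, ← Real.rpow_natCast, ← Real.rpow_mul (norm_nonneg _)]
      congr 1
      push_cast; ring
    rw [p1]; ring
  set d : ℝ := (2 - (N:ℝ)) * l * ‖x‖ ^ (-(N:ℝ)) with hd
  have hdneg : d < 0 := by
    have : 0 < ‖x‖ ^ (-(N:ℝ)) := Real.rpow_pos_of_pos hxn _
    have h2 : (2 - (N:ℝ)) * l < 0 := mul_neg_of_neg_of_pos (by linarith) hl
    exact mul_neg_of_neg_of_pos h2 this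
  have hUl : ∀ s : ℝ, HasDerivAt (fun t : ℝ => U (x + (s * t) • e))
      (s * (fderiv ℝ u x e - c * d)) 0 := by
    intro s
    have := (hul s).add ((hΦ s).const_mul (-c))
    exact HasDerivAt.congr_deriv this (by ring)
  have hG := (hUl 1).sub (hUl (-1))
  have hG' : HasDerivAt (fun t : ℝ => U (x + (1 * t) • e) - U (x + (-1 * t) • e))
      (2 * (fderiv ℝ u x e - c * d)) 0 := HasDerivAt.congr_deriv hG (by ring)
  have hle : 2 * (fderiv ℝ u x e - c * d) ≤ 0 := by
    have hs := (hasDerivAt_iff_tendsto_slope.1 hG').mono_left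
      (nhdsWithin_mono (0:ℝ) (fun t (ht : t ∈ Ioi (0:ℝ)) => (ne_of_gt ht : t ≠ 0)))
    refine le_of_tendsto hs ?_
    have hcont : ContinuousAt (fun t : ℝ => ‖x - t • e‖) 0 := by fun_prop
    have hev : ∀ᶠ t in 𝓝 (0:ℝ), ρ < ‖x - t • e‖ :=
      hcont.eventually_const_lt (by simpa using hρl.trans_le hlx)
    filter_upwards [self_mem_nhdsWithin, mem_nhdsWithin_of_mem_nhds hev] with t ht hev
    have ht' : 0 < t := ht
    have h1 := hg (x + t • e) (by
      rw [inner_add_right, inner_smul_right, real_inner_self_eq_norm_sq, he, hx]; linarith)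
      (by rw [rfx_add_smul he hx]; exact hev.le)
    rw [rfx_add_smul he hx] at h1
    rw [slope_def_field]
    apply div_nonpos_of_nonpos_of_nonneg _ (by linarith)
    simp only [one_mul, mul_zero, neg_mul, neg_smul, zero_smul, add_zero, sub_self, sub_zero,
      ← sub_eq_add_neg]
    linarith
  nlinarith [mul_neg_of_pos_of_neg hc hdneg]

lemma MPCore.step (H : MPCore N p ν V u) (he : ‖e‖ = 1) {l : ℝ} (hl : 0 < l) (hP : PP u e l) :
    ∀ᶠ m in 𝓝 l, PP u e m := by
  have hN3 : (3:ℝ) ≤ N := by exact_mod_cast H.hN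
  obtain ⟨R0, hR0⟩ := H.start
  obtain ⟨ρ, hρ, hρl, hnear⟩ := H.near he (half_pos hl)
  obtain ⟨c, hc, hg⟩ := H.green he hl hρ hP (hnear l (by linarith))
  have hcomp : IsCompact (closedBall (0 : EuclideanSpace ℝ (Fin N)) R0) := isCompact_closedBall _ _
  have hmain := hcomp.eventually_forall_of_forall_eventually (x₀ := l)
    (P := fun m x => m ≤ inner ℝ e x → rfx e m x ≠ 0 → u x ≤ u (rfx e m x)) (by
    intro y _
    have ci : Continuous fun z : ℝ × EuclideanSpace ℝ (Fin N) => inner ℝ e z.2 - z.1 := by fun_prop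
    have cr : Continuous fun z : ℝ × EuclideanSpace ℝ (Fin N) => rfx e z.1 z.2 := rfx_continuous
    have c2 : Continuous fun z : ℝ × EuclideanSpace ℝ (Fin N) => z.2 := continuous_snd
    rcases lt_trichotomy (inner ℝ e y) l with h | h | h
    · have := ci.continuousAt.eventually_lt_const (show inner ℝ e (l, y).2 - (l, y).1 < 0 by simp; linarith)
      filter_upwards [this] with z hz h1
      linarith
    · -- on the plane
      have hy0 : y ≠ 0 := ne_zero_of_inner hl h.ge
      have hd := H.hopf he hl (by linarith) hc hg h
      have hC1 : ContinuousAt (fun z => fderiv ℝ u z e) y :=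
        (((H.hC y hy0).fderiv_right (m := 1) (by norm_num)).continuousAt).clm_apply continuousAt_const
      have hev1 : ∀ᶠ z in 𝓝 y, fderiv ℝ u z e < 0 ∧ z ≠ 0 :=
        (hC1.eventually_lt_const hd).and (isOpen_ne.mem_nhds hy0)
      obtain ⟨δ, hδ, hball⟩ := Metric.eventually_nhds_iff_ball.1 hev1
      have ev1 : ∀ᶠ z : ℝ × EuclideanSpace ℝ (Fin N) in 𝓝 (l, y), z.2 ∈ ball y δ :=
        c2.continuousAt.eventually (ball_mem_nhds y hδ)
      have ev2 : ∀ᶠ z : ℝ × EuclideanSpace ℝ (Fin N) in 𝓝 (l, y), rfx e z.1 z.2 ∈ ball y δ := by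
        apply cr.continuousAt.eventually
        simp only [rfx_fixed h]
        exact ball_mem_nhds y hδ
      filter_upwards [ev1, ev2] with z hz1 hz2 h1 _
      set s : ℝ := 2 * (inner ℝ e z.2 - z.1) with hs
      have hs0 : 0 ≤ s := by linarith
      set r := rfx e z.1 z.2 with hr
      have hzr : z.2 = r + s • e := by rw [hr, rfx, hs]; module
      have hseg : ∀ t ∈ Icc (0:ℝ) s, r + t • e ∈ ball y δ := by
        intro t ht
        rcases hs0.eq_or_lt with h0 | h0
        · have : t = 0 := le_antisymm (h0 ▸ ht.2) ht.1
          simpa [this] using hz2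
        · have hcv := (convex_ball y δ) hz2 (hzr ▸ hz1) (a := 1 - t / s) (b := t / s)
            (by rw [sub_nonneg, div_le_one h0]; exact ht.2) (div_nonneg ht.1 hs0) (by ring)
          have : (1 - t / s) • r + (t / s) • (r + s • e) = r + t • e := by
            have h5 : t = (t / s) * s := by field_simp
            have h6 : t • e = ((t / s) * s) • e := by rw [← h5]
            rw [h6]
            module
          rwa [this] at hcv
      have hder : ∀ t ∈ Icc (0:ℝ) s, HasDerivAt (fun t : ℝ => u (r + t • e)) (fderiv ℝ u (r + t • e) e) t := by
        intro t ht
        have h6 := hball _ (hseg t ht)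
        have h7 := ((H.hC _ h6.2).differentiableAt (by simp)).hasFDerivAt
        have h8 : HasDerivAt (fun t : ℝ => r + t • e) e t := by
          simpa using ((hasDerivAt_id t).smul_const e).const_add r
        exact h7.comp_hasDerivAt t h8
      have hanti : AntitoneOn (fun t : ℝ => u (r + t • e)) (Icc 0 s) := by
        apply antitoneOn_of_deriv_nonpos (convex_Icc 0 s)
        · intro t ht; exact (hder t ht).continuousAt.continuousWithinAt
        · intro t ht
          exact (hder t (interior_subset ht)).differentiableAt.differentiableWithinAt
        · intro t ht
          rw [(hder t (interior_subset ht)).deriv]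
          exact (hball _ (hseg t (interior_subset ht))).1.le
      have := hanti (left_mem_Icc.2 hs0) (right_mem_Icc.2 hs0) hs0
      simp only [zero_smul, add_zero] at this
      rwa [← hzr] at this
    · have hy0 : y ≠ 0 := ne_zero_of_inner hl h.le
      rcases lt_or_ge ‖rfx e l y‖ ρ with hb | hb
      · have ev1 := cr.norm.continuousAt.eventually_lt_const (show ‖rfx e (l, y).1 (l, y).2‖ < ρ from hb)
        have ev2 := (continuous_fst (X := ℝ) (Y := EuclideanSpace ℝ (Fin N))).continuousAt.eventually_const_lt
          (show l / 2 < (l, y).1 by simp; linarith)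
        filter_upwards [ev1, ev2] with z h1 h2 h3 h4
        linarith [hnear z.1 h2.le z.2 h3 h4 h1.le]
      · have hr0 : rfx e l y ≠ 0 := norm_pos_iff.1 (hρ.trans_le hb)
        have hlt : u y < u (rfx e l y) := by
          have h1 := hg y h.le hb
          simp only [Pi.add_apply, Pi.smul_apply, smul_eq_mul] at h1
          have h2 : ‖y‖ ^ (2 - (N:ℝ)) < ‖rfx e l y‖ ^ (2 - (N:ℝ)) :=
            Real.rpow_lt_rpow_of_neg (norm_pos_iff.2 hr0) (norm_rfx_lt he hl h) (by linarith)
          nlinarith [mul_lt_mul_of_pos_left h2 hc]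
        have k1 : ContinuousAt (fun z : ℝ × EuclideanSpace ℝ (Fin N) => u z.2) (l, y) :=
          ContinuousAt.comp (g := u) (f := fun z : ℝ × EuclideanSpace ℝ (Fin N) => z.2)
            (H.hC y hy0).continuousAt c2.continuousAt
        have k2 : ContinuousAt (fun z : ℝ × EuclideanSpace ℝ (Fin N) => u (rfx e z.1 z.2)) (l, y) :=
          ContinuousAt.comp (g := u) (f := fun z : ℝ × EuclideanSpace ℝ (Fin N) => rfx e z.1 z.2)
            (H.hC _ hr0).continuousAt cr.continuousAt
        filter_upwards [(k2.sub k1).eventually_const_lt (show 0 < u (rfx e (l, y).1 (l, y).2) - u (l, y).2 by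
          simp only; linarith)] with z hz _ _
        simp only [Pi.sub_apply] at hz
        linarith)
  filter_upwards [hmain, eventually_gt_nhds hl] with m hm hm0
  exact hR0 e he m hm0 fun x hx => hm x (by simpa using hx)

lemma MPCore.all (H : MPCore N p ν V u) (he : ‖e‖ = 1) : ∀ l > 0, PP u e l := by
  intro l0 hl0
  obtain ⟨R0, hR0⟩ := H.start
  have hstart : ∀ l, R0 < l → 0 < l → PP u e l := by
    intro l hl hl'
    apply hR0 e he l hl'
    intro x hx hx' _
    linarith [inner_le_norm' he x]
  set S : Set ℝ := {l | l0 ≤ l ∧ ∀ m, l ≤ m → PP u e m} with hS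
  have hne : S.Nonempty := by
    refine ⟨max l0 (R0 + 1), le_max_left _ _, fun m hm => ?_⟩
    have h1 := (le_max_left l0 (R0+1)).trans hm
    have h2 := (le_max_right l0 (R0+1)).trans hm
    exact hstart m (by linarith) (by linarith)
  have hbd : BddBelow S := ⟨l0, fun l hl => hl.1⟩
  set s := sInf S with hs
  have hs0 : l0 ≤ s := le_csInf hne fun l hl => hl.1
  have hspos : 0 < s := hl0.trans_le hs0
  have habove : ∀ m, s < m → PP u e m := by
    intro m hm
    obtain ⟨l, hlS, hlm⟩ := exists_lt_of_csInf_lt hne hm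
    exact hlS.2 m hlm.le
  have hPs : PP u e s := by
    intro x hx hr
    rcases hx.eq_or_lt with h | h
    · rw [rfx_fixed h.symm]
    · have hc : ContinuousAt (fun m : ℝ => u (rfx e m x)) s := by
        have : Continuous fun m : ℝ => rfx e m x := by unfold rfx; fun_prop
        exact ContinuousAt.comp (g := u) (f := fun m : ℝ => rfx e m x)
          (H.hC _ hr).continuousAt this.continuousAt
      have hne' : ∀ᶠ m in 𝓝 s, rfx e m x ≠ 0 := by
        have : Continuous fun m : ℝ => rfx e m x := by unfold rfx; fun_prop
        exact this.continuousAt.eventually (isOpen_ne.mem_nhds hr)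
      refine ge_of_tendsto (hc.tendsto.mono_left (nhdsWithin_le_nhds (s := Ioi s))) ?_
      filter_upwards [self_mem_nhdsWithin, mem_nhdsWithin_of_mem_nhds hne',
        mem_nhdsWithin_of_mem_nhds (eventually_lt_nhds h)] with m h1 h2 h3
      exact habove m h1 x h3.le h2
  rcases hs0.eq_or_lt with h | h
  · rw [h]; exact hPs
  · exfalso
    obtain ⟨δ, hδ, hb⟩ := Metric.eventually_nhds_iff_ball.1 (H.step he hspos hPs)
    set m0 := max l0 (s - δ / 2) with hm0
    have hm0s : m0 < s := max_lt h (by linarith)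
    have : m0 ∈ S := by
      refine ⟨le_max_left _ _, fun m hm => ?_⟩
      rcases le_or_gt m s with h1 | h1
      · apply hb
        rw [Real.ball_eq_Ioo]
        have := (le_max_right l0 (s - δ/2)).trans hm
        exact ⟨by linarith, by linarith⟩
      · exact habove m h1
    linarith [csInf_le hbd this]

lemma MPCore.zero (H : MPCore N p ν V u) (he : ‖e‖ = 1) {x : EuclideanSpace ℝ (Fin N)}
    (hx : 0 < inner ℝ e x) : u x ≤ u (rfx e 0 x) := by
  have hx0 := ne_zero_of_inner hx le_rfl
  have hr : rfx e 0 x ≠ 0 := by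
    have := norm_rfx_sq he 0 x
    rw [← norm_pos_iff]
    have h2 : 0 < ‖x‖ := norm_pos_iff.2 hx0
    by_contra h
    have h3 : ‖rfx e 0 x‖ = 0 := le_antisymm (not_lt.1 h) (norm_nonneg _)
    rw [h3] at this
    nlinarith
  have hcr : Continuous fun m : ℝ => rfx e m x := by unfold rfx; fun_prop
  have hc : ContinuousAt (fun m : ℝ => u (rfx e m x)) 0 :=
    ContinuousAt.comp (g := u) (f := fun m : ℝ => rfx e m x)
      (H.hC _ hr).continuousAt hcr.continuousAt
  have hne' : ∀ᶠ m in 𝓝 (0:ℝ), rfx e m x ≠ 0 :=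
    hcr.continuousAt.eventually (isOpen_ne.mem_nhds hr)
  refine ge_of_tendsto (hc.tendsto.mono_left (nhdsWithin_le_nhds (s := Ioi 0))) ?_
  filter_upwards [self_mem_nhdsWithin, mem_nhdsWithin_of_mem_nhds hne',
    mem_nhdsWithin_of_mem_nhds (eventually_lt_nhds hx)] with m h1 h2 h3
  exact H.all he m h1 x h3.le h2

lemma MPCore.radial_le (H : MPCore N p ν V u) {x y : EuclideanSpace ℝ (Fin N)} (hxy : ‖x‖ = ‖y‖) :
    u x ≤ u y := by
  by_cases h : x = y
  · rw [h]
  have hd : 0 < ‖x - y‖ := norm_pos_iff.2 (sub_ne_zero.2 h)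
  set e := ‖x - y‖⁻¹ • (x - y) with he
  have he1 : ‖e‖ = 1 := by rw [he, norm_smul, norm_inv, norm_norm, inv_mul_cancel₀ hd.ne']
  have hsq : ‖x - y‖ ^ 2 = 2 * inner ℝ (x - y) x := by
    rw [norm_sub_sq_real, inner_sub_left, real_inner_self_eq_norm_sq, ← hxy, real_inner_comm]; ring
  have hin : inner ℝ e x = ‖x - y‖ / 2 := by
    rw [he, inner_smul_left]
    have : inner ℝ (x - y) x = ‖x - y‖ ^ 2 / 2 := by linarith
    rw [this]; simp; field_simp
  have := H.zero he1 (x := x) (by rw [hin]; positivity)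
  have hr : rfx e 0 x = y := by
    unfold rfx
    rw [hin, he, smul_smul]
    have : (2 * (0 - ‖x - y‖ / 2)) * ‖x - y‖⁻¹ = -1 := by field_simp; ring
    rw [this]; module
  rwa [hr] at this

lemma MPCore.concl (H : MPCore N p ν V u) :
    (∀ x y : EuclideanSpace ℝ (Fin N), x ≠ 0 → ‖x‖ = ‖y‖ → u x = u y) ∧
    (∀ x y : EuclideanSpace ℝ (Fin N), x ≠ 0 → ‖x‖ ≤ ‖y‖ → u y ≤ u x) := by
  refine ⟨fun x y _ h => le_antisymm (H.radial_le h) (H.radial_le h.symm), ?_⟩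
  intro x y hx h
  have hxn : 0 < ‖x‖ := norm_pos_iff.2 hx
  set e := ‖x‖⁻¹ • x with he
  have he1 : ‖e‖ = 1 := by rw [he, norm_smul, norm_inv, norm_norm, inv_mul_cancel₀ hxn.ne']
  have hxe : x = ‖x‖ • e := by rw [he, smul_smul, mul_inv_cancel₀ hxn.ne', one_smul]
  set z := ‖y‖ • e with hz
  have hzn : ‖y‖ = ‖z‖ := by rw [hz, norm_smul, he1, norm_norm, mul_one]
  refine (H.radial_le hzn).trans ?_
  have hez : inner ℝ e z = ‖y‖ := by
    rw [hz, inner_smul_right, real_inner_self_eq_norm_sq, he1]; ring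
  have hr : rfx e ((‖x‖ + ‖y‖) / 2) z = x := by
    unfold rfx
    rw [hez, hz]
    refine Eq.trans ?_ hxe.symm
    module
  have := H.all he1 ((‖x‖ + ‖y‖) / 2) (by linarith) z (by rw [hez]; linarith) (by rw [hr]; exact hx)
  rwa [hr] at this

end core

lemma exists_radius {N : ℕ} {P : EuclideanSpace ℝ (Fin N) → Prop}
    (h : ∀ᶠ x in Filter.comap (fun x : EuclideanSpace ℝ (Fin N) => ‖x‖) Filter.atTop, P x) :
    ∃ R : ℝ, 1 ≤ R ∧ ∀ x, R ≤ ‖x‖ → P x := by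
  rw [Filter.eventually_comap, Filter.eventually_atTop] at h
  obtain ⟨R, hR⟩ := h
  exact ⟨max 1 R, le_max_left _ _, fun x hx => hR ‖x‖ ((le_max_right _ _).trans hx) x rfl⟩

lemma mk_core (N : ℕ) (hN : 3 ≤ N) (p : ℝ) (hp : (N:ℝ) / ((N:ℝ) - 2) < p)
    (V : EuclideanSpace ℝ (Fin N) → ℝ)
    (hVnonneg : ∀ x : EuclideanSpace ℝ (Fin N), x ≠ 0 → 0 ≤ V x)
    (hVle1 : ∀ x : EuclideanSpace ℝ (Fin N), x ≠ 0 → V x ≤ 1)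
    (hVdecr : ∀ x y : EuclideanSpace ℝ (Fin N), x ≠ 0 → ‖x‖ ≤ ‖y‖ → V y ≤ V x)
    (ν : ℝ) (hν : 0 < ν) (u : EuclideanSpace ℝ (Fin N) → ℝ)
    (hu : FastDecaySol N p V u ν) (hu0 : SingAtOrigin N p u) : MPCore N p ν V u := by
  obtain ⟨hreg, hpos, heq, hlim⟩ := hu
  have hN3 : (3:ℝ) ≤ N := by exact_mod_cast hN
  have hN2 : 0 < (N:ℝ) - 2 := by linarith
  have hpN : (N:ℝ) < p * ((N:ℝ) - 2) := by rwa [div_lt_iff₀ hN2] at hp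
  have hp2 : 2 < (p - 1) * ((N:ℝ) - 2) := by linarith
  have hp1 : 1 < p := by
    by_contra h
    push Not at h
    nlinarith
  have hC : ∀ x, x ≠ 0 → ContDiffAt ℝ 2 u x := fun x hx =>
    hreg.contDiffAt (isOpen_compl_singleton.mem_nhds hx)
  obtain ⟨R1, hR1, hup⟩ := exists_radius (hlim.eventually_lt_const (show ν < ν + 1 by linarith))
  have hupper : ∀ x, R1 ≤ ‖x‖ → u x ≤ (ν + 1) * ‖x‖ ^ (2 - (N:ℝ)) := by
    intro x hx
    have hxp : 0 < ‖x‖ := by linarith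
    have h1 := mul_le_mul_of_nonneg_right (hup x hx).le (Real.rpow_nonneg hxp.le (2 - (N:ℝ)))
    rwa [mul_assoc, ← Real.rpow_add hxp, show (N:ℝ) - 2 + (2 - N) = 0 by ring, Real.rpow_zero,
      mul_one] at h1
  refine ⟨hN, hp1, hν, hC, hpos, ?_, hVnonneg, hVle1, hVdecr, ?_, ?_, ?_, ?_⟩
  · intro x hx
    rw [← lap_eq_laplacian (hC x hx), ← heq x hx, neg_neg]
  · intro r hr
    have hK : IsCompact (closedBall (0 : EuclideanSpace ℝ (Fin N)) R1 ∩ {x | r ≤ ‖x‖}) :=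
      (isCompact_closedBall _ _).inter_right (isClosed_le continuous_const continuous_norm)
    have hcont : ContinuousOn u (closedBall (0 : EuclideanSpace ℝ (Fin N)) R1 ∩ {x | r ≤ ‖x‖}) := by
      intro x hx
      have : x ≠ 0 := norm_pos_iff.1 (hr.trans_le hx.2)
      exact (hC x this).continuousAt.continuousWithinAt
    obtain ⟨M, hM⟩ := hK.bddAbove_image hcont
    refine ⟨max M (ν + 1), fun x hx => ?_⟩
    rcases le_total ‖x‖ R1 with h | h
    · exact (hM ⟨x, ⟨by simpa using h, hx⟩, rfl⟩).trans (le_max_left _ _)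
    · refine (hupper x h).trans (le_trans ?_ (le_max_right _ _))
      have : ‖x‖ ^ (2 - (N:ℝ)) ≤ 1 :=
        Real.rpow_le_one_of_one_le_of_nonpos (hR1.trans h) (by linarith)
      nlinarith
  · intro M
    have hs : 0 < 2 / (p - 1) := div_pos two_pos (by linarith)
    have hcp : 0 < cp N p := by
      unfold cp
      apply Real.rpow_pos_of_pos
      apply mul_pos hs
      have : 2 / (p - 1) < (N:ℝ) - 2 := by
        rw [div_lt_iff₀ (by linarith)]; linarith
      linarith
    have h1 := hu0.eventually_const_lt (show cp N p / 2 < cp N p by linarith)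
    have h2 : ∀ᶠ x : EuclideanSpace ℝ (Fin N) in 𝓝[{0}ᶜ] 0, M * ‖x‖ ^ (2 / (p - 1)) < cp N p / 2 := by
      have hc : ContinuousAt (fun x : EuclideanSpace ℝ (Fin N) => M * ‖x‖ ^ (2 / (p - 1))) 0 :=
        continuousAt_const.mul (continuous_norm.continuousAt.rpow_const (Or.inr hs.le))
      apply mem_nhdsWithin_of_mem_nhds
      apply hc.eventually_lt_const
      beta_reduce
      rw [norm_zero, Real.zero_rpow hs.ne', mul_zero]
      linarith
    have h3 := h1.and h2
    rw [eventually_nhdsWithin_iff, Metric.eventually_nhds_iff_ball] at h3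
    obtain ⟨δ, hδ, h⟩ := h3
    refine ⟨δ / 2, by positivity, fun x hx hxd => ?_⟩
    have h4 := h x (by rw [mem_ball_zero_iff]; linarith) hx
    have h5 : 0 < ‖x‖ ^ (2 / (p - 1)) := Real.rpow_pos_of_pos (norm_pos_iff.2 hx) _
    exact lt_of_mul_lt_mul_right (h4.2.trans h4.1) h5.le
  · intro c hc hcν ε hε
    obtain ⟨R2, hR2, hlow⟩ := exists_radius (hlim.eventually_const_lt hcν)
    have ht : Tendsto (fun r : ℝ => (ν + 1) * r ^ (-(((N:ℝ) - 2) / 2))) atTop (𝓝 ((ν + 1) * 0)) :=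
      (tendsto_rpow_neg_atTop (by linarith)).const_mul _
    rw [mul_zero] at ht
    obtain ⟨R3, hR3⟩ := Filter.eventually_atTop.1 (ht.eventually_lt_const hε)
    refine ⟨max R1 (max R2 R3), fun y hy => ?_⟩
    have a1 := (le_max_left _ _).trans hy
    have a2 := (le_max_left _ _).trans ((le_max_right _ _).trans hy)
    have a3 := (le_max_right _ _).trans ((le_max_right _ _).trans hy)
    have hyp : 0 < ‖y‖ := by linarith
    have b0 : 0 < ‖y‖ ^ (2 - (N:ℝ)) := Real.rpow_pos_of_pos hyp _
    simp only [Uc, Pi.add_apply, Pi.smul_apply, smul_eq_mul]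
    constructor
    · have h1 := mul_le_mul_of_nonneg_right (hlow y a2).le b0.le
      rw [mul_assoc, ← Real.rpow_add hyp, show (N:ℝ) - 2 + (2 - N) = 0 by ring, Real.rpow_zero,
        mul_one] at h1
      linarith
    · have h1 := hupper y a1
      have h2 := hR3 ‖y‖ a3
      have h3 : u y + -c * ‖y‖ ^ (2 - (N:ℝ)) ≤ (ν + 1) * ‖y‖ ^ (2 - (N:ℝ)) := by
        nlinarith [mul_nonneg hc b0.le]
      have h4 := mul_le_mul_of_nonneg_right h3 (Real.rpow_nonneg hyp.le (((N:ℝ) - 2) / 2))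
      rw [mul_assoc (ν + 1), ← Real.rpow_add hyp,
        show 2 - (N:ℝ) + ((N:ℝ) - 2) / 2 = -(((N:ℝ) - 2) / 2) by ring] at h4
      linarith
  · set k : ℝ := (p - 1) * ((N:ℝ) - 2) - 2 with hk
    have ht : Tendsto (fun r : ℝ => (p * (ν + 1) ^ (p - 1)) * r ^ (-k)) atTop
        (𝓝 ((p * (ν + 1) ^ (p - 1)) * 0)) :=
      (tendsto_rpow_neg_atTop (by linarith)).const_mul _
    rw [mul_zero] at ht
    have hq : 0 < (((N:ℝ) - 2) / 2) ^ 2 := by positivity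
    obtain ⟨R3, hR3⟩ := Filter.eventually_atTop.1 (ht.eventually_lt_const hq)
    refine ⟨max R1 R3, fun x hx => ?_⟩
    have a1 := (le_max_left _ _).trans hx.le
    have a2 := (le_max_right _ _).trans hx.le
    have hxp : 0 < ‖x‖ := by linarith
    have hx0 : x ≠ 0 := norm_pos_iff.1 hxp
    rw [lt_div_iff₀ (by positivity)]
    have h1 := Real.rpow_le_rpow (hpos x hx0).le (hupper x a1) (by linarith : 0 ≤ p - 1)
    rw [Real.mul_rpow (by linarith) (Real.rpow_nonneg hxp.le _), ← Real.rpow_mul hxp.le] at h1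
    have h2 := hR3 ‖x‖ a2
    have h3 : ‖x‖ ^ ((2 - (N:ℝ)) * (p - 1)) * ‖x‖ ^ 2 = ‖x‖ ^ (-k) := by
      rw [← Real.rpow_natCast, ← Real.rpow_add hxp]
      congr 1
      rw [hk]; push_cast; ring
    have h4 : p * u x ^ (p - 1) * ‖x‖ ^ 2 ≤ (p * (ν + 1) ^ (p - 1)) * ‖x‖ ^ (-k) := by
      rw [← h3]
      have := mul_le_mul_of_nonneg_left h1 (by positivity : 0 ≤ p * ‖x‖ ^ 2)
      linarith
    linarith

/-- Lemma 4.1, radial symmetry and monotonicity of fast decaying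
solutions. -/
theorem statement_16 (N : ℕ) (hN : 3 ≤ N) (p : ℝ)
    (hp : p ∈ Set.Ioo ((N:ℝ) / ((N:ℝ) - 2)) (pc N))
    (V : EuclideanSpace ℝ (Fin N) → ℝ)
    (hVreg : LocHolderOn V {0}ᶜ)
    (hVnonneg : ∀ x : EuclideanSpace ℝ (Fin N), x ≠ 0 → 0 ≤ V x)
    (hVle1 : ∀ x : EuclideanSpace ℝ (Fin N), x ≠ 0 → V x ≤ 1)
    (c₀ τ₀ : ℝ) (hc₀ : 0 < c₀) (hτ₀ : 0 < τ₀)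
    (hVnear : ∀ x : EuclideanSpace ℝ (Fin N), x ≠ 0 → ‖x‖ ≤ 1 →
      |V x - 1| ≤ c₀ * ‖x‖ ^ τ₀)
    (hVrad : ∀ x y : EuclideanSpace ℝ (Fin N), x ≠ 0 → ‖x‖ = ‖y‖ → V x = V y)
    (hVdecr : ∀ x y : EuclideanSpace ℝ (Fin N), x ≠ 0 → ‖x‖ ≤ ‖y‖ → V y ≤ V x)
    (γ α : ℝ) (hγ : 1 < γ) (hα : ((N:ℝ) - 2) * pc N - N - 2 < α) (hα' : α ≤ 0)
    (hVinf : ∀ x : EuclideanSpace ℝ (Fin N), 1 < ‖x‖ →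
      (1/γ) * ‖x‖ ^ α ≤ V x ∧ V x ≤ γ * ‖x‖ ^ α)
    (ν : ℝ) (hν : 0 < ν) (u : EuclideanSpace ℝ (Fin N) → ℝ)
    (hu : FastDecaySol N p V u ν) (hu0 : SingAtOrigin N p u) :
    (∀ x y : EuclideanSpace ℝ (Fin N), x ≠ 0 → ‖x‖ = ‖y‖ → u x = u y) ∧
    (∀ x y : EuclideanSpace ℝ (Fin N), x ≠ 0 → ‖x‖ ≤ ‖y‖ → u y ≤ u x) := by
  exact (mk_core N hN p hp.1 V hVnonneg hVle1 hVdecr ν hν u hu hu0).concl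
end
end
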